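/- For every fixed positive integer t, r(B_{t,m}) = (2^t + o(1))·m as m → ∞; that is, for every ε > 0 there exists m₀ such that for all m ≥ m₀, (2^t - ε)·m ≤ r(B_{t,m}) ≤ (2^t + ε)·m. -/

import Mathlib

/-- A coloring `c` of the complete graph on `Fin N` contains a monochromatic copy of the
book graph `B_{t,m}`: disjoint sets `A` (the spine, of size `t`) and `Y` (the pages, of
size `m`) such that, for a single color `b`, all pairs inside `A` and all pairs between
`A` and `Y` have color `b`. -/
def HasMonoBook (N t m : ℕ) (c : Fin N → Fin N → Bool) : Prop :=
  ∃ (A Y : Finset (Fin N)) (b : Bool), Disjoint A Y ∧ A.card = t ∧ Y.card = m ∧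
    (∀ v ∈ A, ∀ w ∈ A, v ≠ w → c v w = b) ∧ (∀ v ∈ A, ∀ w ∈ Y, c v w = b)

/-- The book Ramsey number `r(B_{t,m})`: the least `N` such that every symmetric
two-coloring of the edges of `K_N` contains a monochromatic copy of `B_{t,m}`. -/
noncomputable def bookRamsey (t m : ℕ) : ℕ :=
  sInf {N | ∀ c : Fin N → Fin N → Bool, (∀ v w, c v w = c w v) → HasMonoBook N t m c}

section BookAux

open Finset


/-- number of functions with prescribed value on a set -/
lemma br_count {M : Type*} [Fintype M] [DecidableEq M] (E : Finset M) (b : Bool) :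
    #{c : M → Bool | ∀ e ∈ E, c e = b} * 2 ^ #E = 2 ^ Fintype.card M := by
  have : ({c : M → Bool | ∀ e ∈ E, c e = b} : Finset (M → Bool)) =
      Fintype.piFinset (fun e => if e ∈ E then {b} else univ) := by
    ext c
    simp only [mem_filter, mem_univ, true_and, Fintype.mem_piFinset]
    refine forall_congr' fun e => ?_
    by_cases he : e ∈ E <;> simp [he]
  rw [this, Fintype.card_piFinset]
  have h2 : (2:ℕ) ^ #E = ∏ e : M, (if e ∈ E then 2 else 1) := by
    rw [prod_ite]; simp
  rw [h2, ← prod_mul_distrib]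
  have : ∀ e : M, #(if e ∈ E then ({b} : Finset Bool) else univ) * (if e ∈ E then 2 else 1) = 2 := by
    intro e; by_cases he : e ∈ E <;> simp [he]
  rw [prod_congr rfl fun e _ => this e]
  simp

lemma br_count_edges {N t : ℕ} (A W : Finset (Fin N)) (hA : #A = t) (hW : W ⊆ Aᶜ) (b : Bool) :
    (#{c : Sym2 (Fin N) → Bool | ∀ w ∈ W, ∀ v ∈ A, c s(v, w) = b} : ℝ)
      = 2 ^ Fintype.card (Sym2 (Fin N)) * ((1 / 2 ^ t) ^ #W) := by
  have h := br_count ((A ×ˢ W).image (fun p => s(p.1, p.2))) b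
  have hc : #((A ×ˢ W).image (fun p => s(p.1, p.2))) = t * #W := by
    rw [card_image_of_injOn, card_product, hA]
    rintro ⟨a, w⟩ h1 ⟨a', w'⟩ h2 h3
    simp only [coe_product, Set.mem_prod, mem_coe] at h1 h2
    have e1 := mem_compl.1 (hW h1.2)
    have e2 := mem_compl.1 (hW h2.2)
    simp only [Sym2.eq_iff] at h3
    rcases h3 with ⟨rfl, rfl⟩ | ⟨rfl, rfl⟩
    · rfl
    · exact absurd h1.1 e2
  rw [hc] at h
  have hs : ({c : Sym2 (Fin N) → Bool | ∀ e ∈ (A ×ˢ W).image (fun p => s(p.1, p.2)), c e = b} :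
      Finset (Sym2 (Fin N) → Bool)) =
      ({c : Sym2 (Fin N) → Bool | ∀ w ∈ W, ∀ v ∈ A, c s(v, w) = b} :
        Finset (Sym2 (Fin N) → Bool)) := by
    ext c
    simp only [mem_filter, mem_univ, true_and, mem_image, mem_product, Prod.exists]
    constructor
    · intro h w hw v hv; exact h _ ⟨v, w, ⟨hv, hw⟩, rfl⟩
    · rintro h e ⟨v, w, ⟨hv, hw⟩, rfl⟩; exact h w hw v hv
  rw [hs] at h
  have h' : (#{c : Sym2 (Fin N) → Bool | ∀ w ∈ W, ∀ v ∈ A, c s(v, w) = b} : ℝ) * 2 ^ (t * #W)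
      = 2 ^ Fintype.card (Sym2 (Fin N)) := by exact_mod_cast h
  rw [← h', pow_mul, one_div, inv_pow, mul_assoc, mul_inv_cancel₀ (by positivity), mul_one]

lemma br_mgf {N t : ℕ} (A : Finset (Fin N)) (hA : #A = t) (b : Bool) (x : ℝ) (hx : 0 ≤ x) :
    ∑ c : Sym2 (Fin N) → Bool, (1 + x) ^ #{w ∈ Aᶜ | ∀ v ∈ A, c s(v, w) = b}
      ≤ 2 ^ Fintype.card (Sym2 (Fin N)) * (1 + x / 2 ^ t) ^ N := by
  have h1 : ∀ c : Sym2 (Fin N) → Bool, (1 + x) ^ #{w ∈ Aᶜ | ∀ v ∈ A, c s(v, w) = b}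
      = ∑ W ∈ (Aᶜ).powerset, if (∀ w ∈ W, ∀ v ∈ A, c s(v, w) = b) then x ^ #W else 0 := by
    intro c
    rw [← sum_filter, add_comm, ← Finset.sum_pow_mul_eq_add_pow]
    simp only [one_pow, mul_one]
    refine sum_congr ?_ fun _ _ => rfl
    ext W
    simp only [mem_powerset, mem_filter, subset_iff]
    constructor
    · intro h; exact ⟨fun w hw => (h hw).1, fun w hw => (h hw).2⟩
    · rintro ⟨h1, h2⟩ w hw; exact ⟨h1 hw, h2 w hw⟩
  simp_rw [h1]
  rw [sum_comm]
  have h2 : ∀ W ∈ (Aᶜ).powerset,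
      ∑ c : Sym2 (Fin N) → Bool, (if (∀ w ∈ W, ∀ v ∈ A, c s(v, w) = b) then x ^ #W else 0)
      = 2 ^ Fintype.card (Sym2 (Fin N)) * (x / 2 ^ t) ^ #W := by
    intro W hW
    rw [← sum_filter, sum_const, nsmul_eq_mul, br_count_edges A W hA (mem_powerset.1 hW)]
    rw [mul_assoc, ← mul_pow]; congr 2; ring
  rw [sum_congr rfl h2, ← mul_sum]
  have h3 := Finset.sum_pow_mul_eq_add_pow (x / 2 ^ t) (1:ℝ) (Aᶜ)
  simp only [one_pow, mul_one] at h3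
  rw [h3, add_comm]
  gcongr
  · have : 0 ≤ x / 2 ^ t := by positivity
    linarith
  · exact (card_le_univ _).trans (by simp)

lemma br_lower_aux {N t m : ℕ} (x : ℝ) (hx : 0 ≤ x)
    (h : 2 * (N:ℝ) ^ t * (1 + x / 2 ^ t) ^ N < (1 + x) ^ m) :
    ∃ c : Fin N → Fin N → Bool, (∀ v w, c v w = c w v) ∧ ¬ HasMonoBook N t m c := by
  by_contra! hcon
  set K : ℝ := 2 ^ Fintype.card (Sym2 (Fin N)) with hK
  have hKpos : 0 < K := by positivity
  have hall : ∀ c : Sym2 (Fin N) → Bool, (1 + x) ^ m ≤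
      ∑ p ∈ (powersetCard t (univ : Finset (Fin N))) ×ˢ (univ : Finset Bool),
        (1 + x) ^ #{w ∈ p.1ᶜ | ∀ v ∈ p.1, c s(v, w) = p.2} := by
    intro c
    obtain ⟨A, Y, b, hd, hA, hY, -, h2⟩ := hcon (fun v w => c s(v, w)) (fun v w => by
      simp only [Sym2.eq_swap])
    have hm : (A, b) ∈ (powersetCard t (univ : Finset (Fin N))) ×ˢ (univ : Finset Bool) := by
      simp [mem_powersetCard, hA]
    refine le_trans ?_ (single_le_sum (f := fun p : Finset (Fin N) × Bool =>
      (1 + x) ^ #{w ∈ p.1ᶜ | ∀ v ∈ p.1, c s(v, w) = p.2}) (fun p _ => by positivity) hm)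
    refine pow_le_pow_right₀ (by linarith) ?_
    rw [← hY]
    refine card_le_card fun w hw => ?_
    simp only [mem_filter, mem_compl]
    exact ⟨fun hwA => (Finset.disjoint_left.1 hd hwA hw), fun v hv => h2 v hv w hw⟩
  have hs := sum_le_sum (fun c (_ : c ∈ (univ : Finset (Sym2 (Fin N) → Bool))) => hall c)
  rw [sum_comm, sum_const] at hs
  have hb : ∀ p ∈ (powersetCard t (univ : Finset (Fin N))) ×ˢ (univ : Finset Bool),
      ∑ c : Sym2 (Fin N) → Bool, (1 + x) ^ #{w ∈ p.1ᶜ | ∀ v ∈ p.1, c s(v, w) = p.2}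
      ≤ K * (1 + x / 2 ^ t) ^ N := by
    intro p hp
    simp only [mem_product, mem_powersetCard] at hp
    exact br_mgf p.1 hp.1.2 p.2 x hx
  have h3 := hs.trans (sum_le_sum hb)
  rw [sum_const, card_product, card_powersetCard] at h3
  simp only [card_univ, Fintype.card_fin, Fintype.card_bool, nsmul_eq_mul, Fintype.card_fun] at h3
  push_cast at h3
  rw [← hK] at h3
  have h4 : ((N.choose t : ℕ) : ℝ) ≤ (N:ℝ) ^ t := by exact_mod_cast Nat.choose_le_pow N t
  have h5 : (N.choose t : ℝ) * 2 * (K * (1 + x / 2 ^ t) ^ N) ≤ K * (2 * (N:ℝ) ^ t * (1 + x / 2 ^ t) ^ N) := by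
    have : 0 ≤ K * (1 + x / 2 ^ t) ^ N := by positivity
    nlinarith
  have h6 := h3.trans h5
  have := le_of_mul_le_mul_left h6 hKpos
  linarith

lemma br_lower (t : ℕ) (ε : ℝ) (hε : 0 < ε) : ∃ m₀ : ℕ, ∀ m : ℕ, m₀ ≤ m → ∀ N : ℕ,
    (N:ℝ) < (2 ^ t - ε) * m →
    ∃ c : Fin N → Fin N → Bool, (∀ v w, c v w = c w v) ∧ ¬ HasMonoBook N t m c := by
  by_cases hle : (2:ℝ) ^ t ≤ ε
  · refine ⟨0, fun m _ N hN => ?_⟩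
    have : ((2:ℝ) ^ t - ε) * m ≤ 0 := mul_nonpos_of_nonpos_of_nonneg (by linarith) (by positivity)
    have : (0:ℝ) ≤ N := by positivity
    linarith
  push Not at hle
  set T : ℝ := 2 ^ t with hT
  have hTpos : 0 < T := by positivity
  set θ : ℝ := ε / T with hθ
  have hθ0 : 0 < θ := by positivity
  have hθ1 : θ < 1 := by rw [hθ, div_lt_one hTpos]; exact hle
  set ρ : ℝ := Real.exp (θ * (1 - θ)) / (1 + θ) with hρ
  have hρ0 : 0 < ρ := by positivity
  have hρ1 : ρ < 1 := by
    rw [hρ, div_lt_one (by linarith)]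
    have hlt : θ * (1 - θ) < 1 := by nlinarith
    have h1 : 1 - θ * (1 - θ) ≤ Real.exp (-(θ * (1 - θ))) := by
      have := Real.add_one_le_exp (-(θ * (1 - θ))); linarith
    rw [Real.exp_neg] at h1
    have h2 : Real.exp (θ * (1 - θ)) * (1 - θ * (1 - θ)) ≤ 1 := by
      have := mul_le_mul_of_nonneg_left h1 (Real.exp_pos (θ * (1 - θ))).le
      rwa [mul_inv_cancel₀ (Real.exp_pos _).ne'] at this
    by_contra! h3
    have h4 : (1 + θ) * (1 - θ * (1 - θ)) ≤ 1 :=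
      (mul_le_mul_of_nonneg_right h3 (by linarith)).trans h2
    have : 0 < θ ^ 3 := by positivity
    nlinarith
  have hlim := tendsto_pow_const_mul_const_pow_of_abs_lt_one t (r := ρ) (by rw [abs_of_pos hρ0]; exact hρ1)
  have hC : 0 < 1 / (2 * T ^ t) := by positivity
  have hev := (hlim.eventually (gt_mem_nhds hC)).and (Filter.eventually_ge_atTop 1)
  obtain ⟨m₀, hm₀⟩ := Filter.eventually_atTop.1 hev
  refine ⟨m₀, fun m hm N hN => br_lower_aux θ hθ0.le ?_⟩
  obtain ⟨hm1, hm2⟩ := hm₀ m hm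
  have hmpos : (0:ℝ) < m := by exact_mod_cast hm2
  rw [← hT]
  have hNT : (N:ℝ) ≤ T * m := by nlinarith
  have e1 : (1 + θ / T) ^ N ≤ Real.exp (θ * (1 - θ)) ^ m := by
    have : 1 + θ / T ≤ Real.exp (θ / T) := by have := Real.add_one_le_exp (θ / T); linarith
    calc (1 + θ / T) ^ N ≤ Real.exp (θ / T) ^ N := by gcongr
      _ = Real.exp (N * (θ / T)) := by rw [← Real.exp_nat_mul]
      _ ≤ Real.exp (m * (θ * (1 - θ))) := by
          apply Real.exp_le_exp.2
          have : (N:ℝ) * (θ / T) ≤ ((T - ε) * m) * (θ / T) := by gcongr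
          refine this.trans (le_of_eq ?_)
          have : ε = θ * T := by rw [hθ]; field_simp
          rw [this]; field_simp
      _ = _ := by rw [Real.exp_nat_mul]
  have e2 : Real.exp (θ * (1 - θ)) ^ m = ρ ^ m * (1 + θ) ^ m := by
    rw [← mul_pow, hρ, div_mul_cancel₀]; linarith
  have e3 : (N:ℝ) ^ t ≤ T ^ t * m ^ t := by rw [← mul_pow]; gcongr
  calc 2 * (N:ℝ) ^ t * (1 + θ / T) ^ N ≤ 2 * (T ^ t * m ^ t) * (ρ ^ m * (1 + θ) ^ m) := by
        rw [← e2]; gcongr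
    _ = (2 * T ^ t) * (m ^ t * ρ ^ m) * (1 + θ) ^ m := by ring
    _ < 1 * (1 + θ) ^ m := by
        gcongr
        rw [lt_div_iff₀ (by positivity)] at hm1
        linarith
    _ = _ := one_mul _


lemma br_poly (k : ℕ) (hk : 5 ≤ k) (u : ℝ) (h0 : 0 ≤ u) (h1 : u ≤ 17/10) :
    (k:ℝ) ≤ (2 - u) * (k - 1 + u ^ k) := by
  induction k, hk using Nat.le_induction with
  | base =>
    have hq : 0 ≤ 3 + 2 * u + u ^ 2 - u ^ 4 := by
      have : u ^ 2 ≤ (17/10) ^ 2 := by gcongr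
      have h3 : u ^ 4 ≤ (17/10)^2 * u ^ 2 := by nlinarith [sq_nonneg u]
      have h4 : u ^ 2 ≤ 17/10 * u := by nlinarith
      nlinarith
    have := mul_nonneg (sq_nonneg (u - 1)) hq
    push_cast
    nlinarith
  | succ k hk ih =>
    have key : 0 ≤ (u - 1) * ((2 - u) * u ^ k - 1) := by
      rcases le_total u 1 with hu | hu
      · have h2 : u ^ k ≤ u ^ 1 := pow_le_pow_of_le_one h0 hu (by omega)
        have : (2 - u) * u ^ k ≤ (2 - u) * u ^ 1 := by gcongr; linarith
        apply mul_nonneg_of_nonpos_of_nonpos (by linarith)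
        nlinarith [sq_nonneg (u - 1)]
      · have h2 : u ^ 5 ≤ u ^ k := pow_le_pow_right₀ hu hk
        have h3 : 1 + (5:ℕ) * (u - 1) ≤ (1 + (u - 1)) ^ 5 :=
          one_add_mul_le_pow (by linarith) 5
        have h3' : 1 + 5 * (u - 1) ≤ u ^ 5 := by
          push_cast at h3; convert h3 using 2; ring
        have : (2 - u) * (1 + 5 * (u - 1)) ≤ (2 - u) * u ^ k := by
          gcongr <;> linarith
        apply mul_nonneg (by linarith)
        nlinarith
    push_cast
    have : (2 - u) * ((k:ℝ) + 1 - 1 + u ^ (k + 1)) =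
      (2 - u) * (k - 1 + u ^ k) + 1 + (u - 1) * ((2 - u) * u ^ k - 1) := by ring
    linarith

lemma br_exp_le (s y : ℝ) (hs : 0 < 1 + s) (h : 1 ≤ y * (1 + s)) : Real.exp (-s) ≤ y := by
  rw [Real.exp_neg]
  have h1 : 1 + s ≤ Real.exp s := by have := Real.add_one_le_exp s; linarith
  calc (Real.exp s)⁻¹ ≤ (1 + s)⁻¹ := by gcongr
    _ ≤ y := by rw [inv_eq_one_div, div_le_iff₀ hs]; exact h

lemma br_17 (k : ℕ) (hk : 5 ≤ k) : 2 * (k:ℝ) ≤ (17/10) ^ k := by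
  induction k, hk using Nat.le_induction with
  | base => norm_num
  | succ k hk ih =>
    have : (5:ℝ) ≤ k := by exact_mod_cast hk
    rw [pow_succ]; push_cast; nlinarith

lemma br_onevar (k : ℕ) (hk : 4 ≤ k) (u : ℝ) (h0 : 0 ≤ u) (hu : u ^ k < 2 * k) :
    Real.exp (-((u ^ k - 1) / k)) ≤ 2 - u := by
  have hkR : (4:ℝ) ≤ k := by exact_mod_cast hk
  have hupos : 0 ≤ u ^ k := by positivity
  have hs : 0 < 1 + (u ^ k - 1) / k := by
    have : 1 + (u ^ k - 1) / k = (k - 1 + u ^ k) / k := by field_simp; ring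
    rw [this]; apply div_pos <;> linarith
  have main : (k:ℝ) ≤ (2 - u) * (k - 1 + u ^ k) → Real.exp (-((u ^ k - 1) / k)) ≤ 2 - u := by
    intro h
    apply br_exp_le _ _ hs
    have : (2 - u) * (1 + (u ^ k - 1) / k) = (2 - u) * (k - 1 + u ^ k) / k := by field_simp; ring
    rw [this, le_div_iff₀ (by linarith)]; linarith
  rcases hk.eq_or_lt with rfl | hk5
  · norm_num at hu ⊢ 
    rcases le_total u (3/2) with h | h
    · norm_num at main
      apply main
      have hq : 0 ≤ 2 + u - u ^ 3 := by nlinarith [mul_nonneg h0 h0, mul_nonneg (mul_nonneg h0 h0) (sub_nonneg.2 h), mul_nonneg h0 (sub_nonneg.2 h)]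
      nlinarith [mul_nonneg (sq_nonneg (u - 1)) hq]
    · have hu17 : u < 169/100 := by
        by_contra! h'
        have : (169/100:ℝ) ^ 4 ≤ u ^ 4 := by gcongr
        norm_num at this; linarith
      have he : Real.exp (-1) < 0.37 := Real.exp_neg_one_lt_d9.trans (by norm_num)
      rcases le_total u (8/5) with h2 | h2
      · have : (3/2:ℝ) ^ 4 ≤ u ^ 4 := by gcongr
        have h3 : Real.exp (-((u ^ 4 - 1) / 4)) ≤ Real.exp (-1) := by
          apply Real.exp_le_exp.2; norm_num at this; linarith
        have h4 : Real.exp ((1 - u ^ 4) / 4) = Real.exp (-((u ^ 4 - 1) / 4)) := by congr 1; ring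
        norm_num at he
        first | rw [h4]; linarith | linarith
      · have : (8/5:ℝ) ^ 4 ≤ u ^ 4 := by gcongr
        have h3 : Real.exp (-((u ^ 4 - 1) / 4)) ≤ Real.exp (-1) * Real.exp (-(3/8)) := by
          rw [← Real.exp_add]
          apply Real.exp_le_exp.2; norm_num at this; linarith
        have h5 : Real.exp (-(3/8)) ≤ 8/11 := br_exp_le _ _ (by norm_num) (by norm_num)
        have h6 : Real.exp (-1) * Real.exp (-(3/8)) ≤ 0.37 * (8/11) := by gcongr
        norm_num at h6
        have h4 : Real.exp ((1 - u ^ 4) / 4) = Real.exp (-((u ^ 4 - 1) / 4)) := by congr 1; ring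
        first | rw [h4]; linarith | linarith
  · apply main
    apply br_poly k hk5 u h0
    by_contra! h
    have : (17/10:ℝ) ^ k ≤ u ^ k := by gcongr
    have := br_17 k hk5
    linarith

/-- The key inequality. -/
lemma br_key (k : ℕ) (hk : 1 ≤ k) (y : Fin k → ℝ) (h0 : ∀ i, 0 ≤ y i) (h1 : ∀ i, y i ≤ 1) :
    2 / 2 ^ k ≤ ∏ i, y i + (∑ i, (1 - y i) ^ k) / k := by
  rcases Nat.lt_or_ge k 4 with hk4 | hk4
  · interval_cases k
    · simp
    · simp only [Fin.prod_univ_two, Fin.sum_univ_two]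
      push_cast
      nlinarith [sq_nonneg (y 0 + y 1 - 1)]
    · simp only [Fin.prod_univ_three, Fin.sum_univ_three]
      push_cast
      have a0 := h0 0
      have a1 := h0 1
      have a2 := h0 2
      have b0 := h1 0
      have b1 := h1 1
      have b2 := h1 2
      generalize y 0 = a at *
      generalize y 1 = b at *
      generalize y 2 = c at *
      obtain ⟨x, rfl⟩ : ∃ x, a = 1 - x := ⟨1 - a, by ring⟩
      obtain ⟨z, rfl⟩ : ∃ x, b = 1 - x := ⟨1 - b, by ring⟩
      obtain ⟨w, rfl⟩ : ∃ x, c = 1 - x := ⟨1 - c, by ring⟩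
      set e1 := x + z + w with he1
      set e2 := x * z + x * w + z * w with he2
      have hx : 0 ≤ x := by linarith
      have hz : 0 ≤ z := by linarith
      have hw : 0 ≤ w := by linarith
      have e2n : 0 ≤ e2 := by positivity
      have e2l : 3 * e2 ≤ e1 ^ 2 := by
        rw [he1, he2]; nlinarith [sq_nonneg (x - z), sq_nonneg (x - w), sq_nonneg (z - w)]
      have id : (1 - x) * (1 - z) * (1 - w) + ((1 - (1 - x)) ^ 3 + (1 - (1 - z)) ^ 3 + (1 - (1 - w)) ^ 3) / 3
         = 1 - e1 + e1 ^ 3 / 3 + e2 * (1 - e1) := by rw [he1, he2]; ring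
      rw [id]
      have e1n : 0 ≤ e1 := by positivity
      rcases le_total e1 1 with h | h
      · have := mul_nonneg e2n (sub_nonneg.2 h)
        nlinarith [mul_nonneg (sq_nonneg (e1 - 1)) (by linarith : 0 ≤ e1 + 2)]
      · have := mul_nonneg (sub_nonneg.2 e2l) (sub_nonneg.2 h)
        nlinarith [sq_nonneg (e1 - 3/2)]
  · have hkpos : (0:ℝ) < k := by positivity
    by_cases hbad : ∃ i, 2 * (k:ℝ) ≤ (2 * (1 - y i)) ^ k
    · obtain ⟨i, hi⟩ := hbad
      have h2 : (1 - y i) ^ k ≤ ∑ i, (1 - y i) ^ k :=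
        single_le_sum (f := fun i => (1 - y i) ^ k)
          (fun j _ => pow_nonneg (by linarith [h1 j]) _) (mem_univ i)
      have h3 : 0 ≤ ∏ i, y i := prod_nonneg fun i _ => h0 i
      rw [mul_pow] at hi
      have : 2 / 2 ^ k ≤ (∑ i, (1 - y i) ^ k) / k := by
        rw [div_le_div_iff₀ (by positivity) hkpos]
        nlinarith [pow_pos (two_pos : (0:ℝ) < 2) k]
      linarith
    · push Not at hbad
      have hy : ∀ i, Real.exp (-(((2 * (1 - y i)) ^ k - 1) / k)) / 2 ≤ y i := by
        intro i
        have := br_onevar k hk4 (2 * (1 - y i)) (by linarith [h1 i]) (hbad i)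
        linarith
      have hp : ∏ i, (Real.exp (-(((2 * (1 - y i)) ^ k - 1) / k)) / 2) ≤ ∏ i, y i :=
        prod_le_prod (fun i _ => by positivity) (fun i _ => hy i)
      rw [prod_div_distrib, ← Real.exp_sum] at hp
      simp only [prod_const, card_univ, Fintype.card_fin] at hp
      have hsum : ∑ i, (-(((2 * (1 - y i)) ^ k - 1) / k)) =
          1 - 2 ^ k * ((∑ i, (1 - y i) ^ k) / k) := by
        simp only [mul_pow, sum_neg_distrib, ← sum_div, sum_sub_distrib, ← mul_sum, sum_const,
          card_univ, Fintype.card_fin, nsmul_eq_mul]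
        field_simp; ring
      rw [hsum] at hp
      have h5 := Real.add_one_le_exp (1 - 2 ^ k * ((∑ i, (1 - y i) ^ k) / k))
      have h6 : (2 - 2 ^ k * ((∑ i, (1 - y i) ^ k) / k)) / 2 ^ k ≤ ∏ i, y i := by
        refine le_trans ?_ hp
        gcongr; linarith
      rw [sub_div, mul_div_cancel_left₀ _ (by positivity)] at h6
      linarith


/-- all pairs in `A` have colour `b` -/
def BrMono {α : Type*} (c : α → α → Bool) (b : Bool) (A : Finset α) : Prop :=
  ∀ v ∈ A, ∀ w ∈ A, v ≠ w → c v w = b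

/-- common `b`-neighbours of `A` -/
def brPages {α : Type*} [Fintype α] (c : α → α → Bool) (b : Bool) (A : Finset α) : Finset α :=
  {v : α | ∀ a ∈ A, c v a = b}

lemma BrMono.insert {α : Type*} [DecidableEq α] {c : α → α → Bool} (hc : ∀ v w, c v w = c w v)
    {b : Bool} {A : Finset α} (h : BrMono c b A) {v : α} (hv : ∀ a ∈ A, c v a = b) :
    BrMono c b (insert v A) := by
  intro x hx y hy hxy
  rcases mem_insert.1 hx with hx | hx <;> rcases mem_insert.1 hy with hy | hy
  · exact absurd (hx.trans hy.symm) hxy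
  · rw [hx]; exact hv y hy
  · rw [hc, hy]; exact hv x hx
  · exact h x hx y hy hxy

lemma br_ramsey_aux {α : Type*} [DecidableEq α] (c : α → α → Bool) (hc : ∀ v w, c v w = c w v)
    (n : ℕ) : ∀ (r : Bool → ℕ), r true + r false = n → ∀ V : Finset α, 2 ^ n ≤ #V →
      ∃ b, ∃ A ⊆ V, #A = r b ∧ BrMono c b A := by
  induction n with
  | zero =>
    intro r hr V _
    exact ⟨true, ∅, empty_subset _, by simp; omega, by intro v hv; simp at hv⟩
  | succ n ih =>
    intro r hr V hV
    by_cases h0 : ∃ b, r b = 0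
    · obtain ⟨b, hb⟩ := h0
      exact ⟨b, ∅, empty_subset _, by simp [hb], by intro v hv; simp at hv⟩
    push Not at h0
    have hVne : V.Nonempty := by
      rw [← card_pos]; have : 0 < 2 ^ (n + 1) := by positivity
      omega
    obtain ⟨v, hv⟩ := hVne
    have hsplit : #{w ∈ V.erase v | c v w = true} + #{w ∈ V.erase v | ¬ c v w = true}
        = #(V.erase v) := card_filter_add_card_filter_not _
    rw [card_erase_of_mem hv] at hsplit
    have hf : ∀ w, (¬ c v w = true) ↔ c v w = false := by simp
    simp only [hf] at hsplit
    have : ∃ b, 2 ^ n ≤ #{w ∈ V.erase v | c v w = b} := by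
      by_contra! h
      have h1 := h true
      have h2 := h false
      have : 2 ^ (n + 1) = 2 * 2 ^ n := by ring
      omega
    obtain ⟨b, hb⟩ := this
    have hr' : (Function.update r b (r b - 1)) true + (Function.update r b (r b - 1)) false = n := by
      have := h0 b
      cases b <;> simp [Function.update] <;> omega
    obtain ⟨b', A, hAV, hA, hm⟩ := ih _ hr' _ hb
    by_cases hbb : b' = b
    · subst hbb
      refine ⟨b', insert v A, ?_, ?_, hm.insert hc ?_⟩
      · intro x hx
        rcases mem_insert.1 hx with rfl | hx
        · exact hv
        · have := hAV hx; simp at this; exact this.1.2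
      · rw [card_insert_of_notMem, hA]
        · have := h0 b'; simp; omega
        · intro hvA; have := hAV hvA; simp at this
      · intro a ha; have := hAV ha; simp at this; exact this.2
    · refine ⟨b', A, ?_, ?_, hm⟩
      · intro x hx; have := hAV hx; simp at this; exact this.1.2
      · rw [hA, Function.update_of_ne hbb]

lemma br_ramsey {α : Type*} [DecidableEq α] (c : α → α → Bool) (hc : ∀ v w, c v w = c w v)
    (s : ℕ) (V : Finset α) (hV : 4 ^ s ≤ #V) : ∃ b, ∃ A ⊆ V, #A = s ∧ BrMono c b A := by
  refine br_ramsey_aux c hc (s + s) (fun _ => s) rfl V ?_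
  rw [← two_mul, pow_mul]; exact hV

lemma br_cover {α : Type*} [DecidableEq α] (c : α → α → Bool) (hc : ∀ v w, c v w = c w v)
    (s : ℕ) (hs : 1 ≤ s) (n : ℕ) : ∀ V : Finset α, #V ≤ n → ∃ F : Bool → Finset (Finset α),
      (∀ b, ∀ Q ∈ F b, Q ⊆ V ∧ #Q = s ∧ BrMono c b Q) ∧
      (∀ b, ∀ Q ∈ F b, ∀ Q' ∈ F b, Q ≠ Q' → Disjoint Q Q') ∧
      #V ≤ s * #(F true) + s * #(F false) + 4 ^ s := by
  induction n with
  | zero =>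
    intro V hV
    exact ⟨fun _ => ∅, by simp, by simp, by simp at hV; simp [hV]⟩
  | succ n ih =>
    intro V hV
    rcases le_total (#V) (4 ^ s) with h | h
    · exact ⟨fun _ => ∅, by simp, by simp, by simpa using h⟩
    obtain ⟨b, A, hAV, hA, hm⟩ := br_ramsey c hc s V h
    have hcard : #(V \ A) + s = #V := by
      rw [← hA]; exact card_sdiff_add_card_eq_card hAV
    obtain ⟨F, h1, h2, h3⟩ := ih (V \ A) (by omega)
    have hdis : ∀ b', ∀ Q ∈ F b', Disjoint A Q := fun b' Q hQ =>
      disjoint_of_subset_right (h1 b' Q hQ).1 disjoint_sdiff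
    have hAn : A ∉ F b := by
      intro hAF
      have := hdis b A hAF
      rw [disjoint_self_iff_empty] at this
      rw [this] at hA; simp at hA; omega
    refine ⟨Function.update F b (insert A (F b)), ?_, ?_, ?_⟩
    · intro b' Q hQ
      by_cases hb : b' = b
      · subst hb
        simp only [Function.update_self, mem_insert] at hQ
        rcases hQ with rfl | hQ
        · exact ⟨hAV, hA, hm⟩
        · exact ⟨(h1 b' Q hQ).1.trans sdiff_subset, (h1 b' Q hQ).2⟩
      · rw [Function.update_of_ne hb] at hQ
        exact ⟨(h1 b' Q hQ).1.trans sdiff_subset, (h1 b' Q hQ).2⟩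
    · intro b' Q hQ Q' hQ' hne
      by_cases hb : b' = b
      · subst hb
        simp only [Function.update_self, mem_insert] at hQ hQ'
        rcases hQ with rfl | hQ <;> rcases hQ' with rfl | hQ'
        · exact absurd rfl hne
        · exact hdis _ _ hQ'
        · exact (hdis _ _ hQ).symm
        · exact h2 _ _ hQ _ hQ' hne
      · rw [Function.update_of_ne hb] at hQ hQ'
        exact h2 _ _ hQ _ hQ' hne
    · cases b <;> simp [Function.update, card_insert_of_notMem hAn] <;> linarith

lemma br_pick {α : Type*} [DecidableEq α] (c : α → α → Bool) (hc : ∀ v w, c v w = c w v)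
    (s : ℕ) (hs : 1 ≤ s) (V : Finset α) (hV : 3 * 4 ^ s ≤ #V) :
    ∃ b, ∃ F : Finset (Finset α), (∀ Q ∈ F, Q ⊆ V ∧ #Q = s ∧ BrMono c b Q) ∧
      (∀ Q ∈ F, ∀ Q' ∈ F, Q ≠ Q' → Disjoint Q Q') ∧ #V ≤ 3 * (s * #F) := by
  obtain ⟨F, h1, h2, h3⟩ := br_cover c hc s hs _ V le_rfl
  by_cases h : #V ≤ 3 * (s * #(F true))
  · exact ⟨true, F true, h1 _, h2 _, h⟩
  · exact ⟨false, F false, h1 _, h2 _, by omega⟩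

lemma br_pow_diff (k : ℕ) (a b : ℝ) (hb : 0 ≤ b) (hab : b ≤ a) (ha : a ≤ 1) :
    a ^ k - b ^ k ≤ k * (a - b) := by
  induction k with
  | zero => simp
  | succ n ih =>
    have h1 : b ^ n ≤ 1 := pow_le_one₀ hb (hab.trans ha)
    have h2 : b ^ n ≤ a ^ n := by gcongr
    have : a ^ (n + 1) - b ^ (n + 1) = a * (a ^ n - b ^ n) + (a - b) * b ^ n := by ring
    rw [this]
    have h3 : a * (a ^ n - b ^ n) ≤ 1 * (a ^ n - b ^ n) := by gcongr
    have h4 : (a - b) * b ^ n ≤ (a - b) * 1 := by gcongr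
    push_cast; linarith

lemma br_choose (k s d : ℕ) (hs : 1 ≤ s) (hd : d ≤ s) :
    (s.choose k : ℝ) * (((d:ℝ) / s) ^ k - k ^ 2 / s) ≤ d.choose k := by
  have hsR : (0:ℝ) < s := by exact_mod_cast hs
  set e : ℕ := d + 1 - k with he
  by_cases hdk : d < k
  · have : ((d:ℝ) / s) ^ k - k ^ 2 / s ≤ 0 := by
      have h1 : ((d:ℝ) / s) ^ k ≤ ((d:ℝ) / s) ^ 1 :=
        pow_le_pow_of_le_one (by positivity) (by rw [div_le_one hsR]; exact_mod_cast hd) (by omega)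
      have h2 : (d:ℝ) / s ≤ k ^ 2 / s := by
        gcongr
        have : d ≤ k ^ 2 := by nlinarith
        exact_mod_cast this
      linarith
    have h3 : (0:ℝ) ≤ s.choose k := by positivity
    have h4 : (0:ℝ) ≤ d.choose k := by positivity
    nlinarith
  push Not at hdk
  have heR : (e:ℝ) = d + 1 - k := by rw [he, Nat.cast_sub (by omega)]; push_cast; ring
  have h1 : (e:ℝ) ^ k ≤ k.factorial * d.choose k := by
    have := Nat.pow_sub_le_descFactorial d k
    rw [Nat.descFactorial_eq_factorial_mul_choose] at this
    exact_mod_cast this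
  have h2 : (k.factorial * s.choose k : ℝ) ≤ s ^ k := by
    have := Nat.descFactorial_le_pow s k
    rw [Nat.descFactorial_eq_factorial_mul_choose] at this
    exact_mod_cast this
  rcases Nat.eq_zero_or_pos k with hk0 | hk0
  · subst hk0; simp
  have hk1 : (1:ℝ) ≤ k := by exact_mod_cast hk0
  have h3 : ((d:ℝ) / s) ^ k - ((e:ℝ) / s) ^ k ≤ k * (d / s - e / s) :=
    br_pow_diff k _ _ (by positivity) (by gcongr; omega)
      (by rw [div_le_one hsR]; exact_mod_cast hd)
  have h4 : (k:ℝ) * (d / s - e / s) ≤ k ^ 2 / s := by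
    rw [← sub_div, ← mul_div_assoc]; gcongr; rw [heR]; nlinarith
  have h5 : ((d:ℝ) / s) ^ k - k ^ 2 / s ≤ ((e:ℝ) / s) ^ k := by linarith
  have hf : (0:ℝ) < k.factorial := by exact_mod_cast k.factorial_pos
  calc (s.choose k : ℝ) * (((d:ℝ) / s) ^ k - k ^ 2 / s) ≤ s.choose k * ((e:ℝ) / s) ^ k := by gcongr
    _ ≤ (s ^ k / k.factorial) * ((e:ℝ) / s) ^ k := by
        gcongr; rw [le_div_iff₀ hf]; linarith
    _ = e ^ k / k.factorial := by rw [div_pow]; field_simp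
    _ ≤ d.choose k := by rw [div_le_iff₀ hf]; linarith

/-- Lemma A -/
lemma br_red {α : Type*} [Fintype α] [DecidableEq α] (c : α → α → Bool)
    (k s : ℕ) (hk : 1 ≤ k) (hks : k ≤ s) (b : Bool) (P : ℝ)
    (hP : ∀ A : Finset α, #A = k → BrMono c b A → (#(brPages c b A) : ℝ) ≤ P)
    (F : Finset (Finset α)) (hF : ∀ Q ∈ F, #Q = s ∧ BrMono c b Q)
    (hd : ∀ Q ∈ F, ∀ Q' ∈ F, Q ≠ Q' → Disjoint Q Q') (hne : F.Nonempty) :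
    ∑ v : α, ((#{u ∈ F.biUnion id | c v u = b} : ℝ) / #(F.biUnion id)) ^ k
      ≤ P + k ^ 2 / s * Fintype.card α := by
  have hs : 1 ≤ s := hk.trans hks
  have hsR : (0:ℝ) < s := by exact_mod_cast hs
  have hFpos : (0:ℝ) < #F := by exact_mod_cast hne.card_pos
  have hU : (#(F.biUnion id) : ℝ) = s * #F := by
    rw [card_biUnion (t := id) (fun Q hQ Q' hQ' h => hd Q hQ Q' hQ' h)]
    have : ∑ u ∈ F, #(id u) = ∑ u ∈ F, s := sum_congr rfl fun Q hQ => (hF Q hQ).1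
    rw [this]
    simp [mul_comm]
  have hC : (0:ℝ) < s.choose k := by exact_mod_cast Nat.choose_pos hks
  -- double counting
  have h1 : ∑ Q ∈ F, ∑ K ∈ powersetCard k Q, (#(brPages c b K) : ℝ) ≤ #F * (s.choose k * P) := by
    rw [← nsmul_eq_mul, ← sum_const]
    refine sum_le_sum fun Q hQ => ?_
    have : ∑ K ∈ powersetCard k Q, (#(brPages c b K) : ℝ) ≤ ∑ K ∈ powersetCard k Q, P := by
      refine sum_le_sum fun K hK => ?_
      rw [mem_powersetCard] at hK
      exact hP K hK.2 (fun v hv w hw => (hF Q hQ).2 v (hK.1 hv) w (hK.1 hw))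
    rw [sum_const, card_powersetCard, (hF Q hQ).1, nsmul_eq_mul] at this
    exact this
  have h2 : ∀ Q ∈ F, ∑ K ∈ powersetCard k Q, (#(brPages c b K) : ℝ)
      = ∑ v : α, ((#{u ∈ Q | c v u = b}).choose k : ℝ) := by
    intro Q hQ
    have : ∀ K, (#(brPages c b K) : ℝ) = ∑ v : α, if (∀ a ∈ K, c v a = b) then 1 else 0 := by
      intro K; rw [brPages, sum_boole]; congr!
    simp only [this]
    rw [sum_comm]
    refine sum_congr rfl fun v _ => ?_
    rw [← sum_filter, sum_const, nsmul_eq_mul, mul_one, ← card_powersetCard]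
    congr 2
    ext K
    simp only [mem_filter, mem_powersetCard, subset_iff]
    grind
  rw [sum_congr rfl h2, sum_comm] at h1
  have h3 : ∀ v : α, #F * s.choose k *
      (((#{u ∈ F.biUnion id | c v u = b} : ℝ) / #(F.biUnion id)) ^ k - k ^ 2 / s)
      ≤ ∑ Q ∈ F, ((#{u ∈ Q | c v u = b}).choose k : ℝ) := by
    intro v
    have e1 : ∀ Q ∈ F, (s.choose k : ℝ) * (((#{u ∈ Q | c v u = b} : ℝ) / s) ^ k - k ^ 2 / s) ≤
        ((#{u ∈ Q | c v u = b}).choose k : ℝ) := by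
      intro Q hQ
      refine br_choose k s _ hs ?_
      rw [← (hF Q hQ).1]; exact card_filter_le _ _
    refine le_trans ?_ (sum_le_sum e1)
    rw [← mul_sum, sum_sub_distrib, sum_const, nsmul_eq_mul]
    have e2 : (#{u ∈ F.biUnion id | c v u = b} : ℝ) = ∑ Q ∈ F, (#{u ∈ Q | c v u = b} : ℝ) := by
      rw [filter_biUnion, card_biUnion]
      · push_cast; rfl
      · intro Q hQ Q' hQ' h
        exact disjoint_filter_filter (hd Q hQ Q' hQ' h)
    obtain ⟨n, rfl⟩ : ∃ n, k = n + 1 := ⟨k - 1, by omega⟩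
    have e3 := pow_sum_div_card_le_sum_pow (s := F) (f := fun Q => (#{u ∈ Q | c v u = b} : ℝ) / s)
      (fun Q _ => by positivity) n
    rw [← sum_div, ← e2] at e3
    have e4 : #F * ((#{u ∈ F.biUnion id | c v u = b} : ℝ) / #(F.biUnion id)) ^ (n + 1)
        ≤ ∑ Q ∈ F, ((#{u ∈ Q | c v u = b} : ℝ) / s) ^ (n + 1) := by
      refine le_trans (le_of_eq ?_) e3
      rw [hU, div_pow, div_pow, mul_pow]; field_simp; ring
    calc _ = (s.choose (n+1) : ℝ) * (#F * ((#{u ∈ F.biUnion id | c v u = b} : ℝ) / #(F.biUnion id)) ^ (n + 1) - #F * (((n + 1 : ℕ) : ℝ) ^ 2 / s)) := by ring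
      _ ≤ _ := by gcongr
  have h4 := (sum_le_sum fun v (_ : v ∈ (univ : Finset α)) => h3 v).trans h1
  rw [← mul_sum, ← mul_assoc] at h4
  have h5 := le_of_mul_le_mul_left h4 (by positivity)
  rw [sum_sub_distrib, sum_const, nsmul_eq_mul, card_univ] at h5
  linarith

/-- greedy Turan -/
lemma br_turan {ι : Type*} (H : ι → ι → Prop) [DecidableRel H] (I : Finset ι) (hI : I.Nonempty)
    (k : ℕ) (h : ∀ i ∈ I, (k - 1) * #{j ∈ I | ¬ H i j} < #I) (r : ℕ) (hr : r ≤ k) :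
    ∃ f : Fin r → ι, (∀ i, f i ∈ I) ∧ ∀ i j, i < j → H (f i) (f j) := by
  induction r with
  | zero => exact ⟨Fin.elim0, fun i => i.elim0, fun i => i.elim0⟩
  | succ r ih =>
    obtain ⟨f, hf, hH⟩ := ih (by omega)
    have : ∃ j ∈ I, ∀ i, H (f i) j := by
      by_contra! hcon
      rcases Nat.eq_zero_or_pos r with h0 | h0
      · subst h0
        obtain ⟨j, hj⟩ := hI
        obtain ⟨i, -⟩ := hcon j hj
        exact i.elim0
      classical
      have hsub : I ⊆ (univ : Finset (Fin r)).biUnion fun i => {j ∈ I | ¬ H (f i) j} := by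
        intro j hj
        obtain ⟨i, hi⟩ := hcon j hj
        simp only [mem_biUnion, mem_univ, true_and, mem_filter]
        exact ⟨i, hj, hi⟩
      have h1 := (card_le_card hsub).trans card_biUnion_le
      have h2 : ∑ i : Fin r, (k - 1) * #{j ∈ I | ¬ H (f i) j} < ∑ i : Fin r, #I :=
        sum_lt_sum_of_nonempty ⟨⟨0, h0⟩, mem_univ _⟩ fun i _ => h _ (hf i)
      rw [← mul_sum] at h2
      simp only [sum_const, card_univ, Fintype.card_fin, smul_eq_mul] at h2
      have h3 : r * #I ≤ (k - 1) * #I := Nat.mul_le_mul_right _ (by omega)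
      have h4 := Nat.mul_le_mul_left (k - 1) h1
      omega
    obtain ⟨j, hj, hjH⟩ := this
    refine ⟨Fin.snoc f j, ?_, ?_⟩
    · intro i
      refine Fin.lastCases ?_ (fun i => ?_) i <;> simp [hj, hf]
    · intro a b hab
      induction b using Fin.lastCases with
      | last =>
        induction a using Fin.lastCases with
        | last => exact absurd hab (lt_irrefl _)
        | cast a => simpa using hjH a
      | cast b =>
        induction a using Fin.lastCases with
        | last => exact absurd hab (not_lt.2 (Fin.le_last _))
        | cast a => simpa using hH a b (by simpa using hab)


lemma br_avg1 {k : ℕ} {α : Type*} [DecidableEq α] (U : Fin k → Finset α) (p : Fin k)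
    (f : (Fin k → α) → ℝ) :
    ∑ x ∈ Fintype.piFinset U, ∑ a ∈ U p, f (Function.update x p a) =
      #(U p) * ∑ x ∈ Fintype.piFinset U, f x := by
  have h2 : (#(U p) : ℝ) * ∑ x ∈ Fintype.piFinset U, f x =
      ∑ x ∈ Fintype.piFinset U, ∑ a ∈ U p, f x := by
    simp [mul_sum]
  rw [h2, ← sum_product', ← sum_product']
  refine sum_nbij' (fun z => (Function.update z.1 p z.2, z.1 p))
    (fun z => (Function.update z.1 p z.2, z.1 p)) ?_ ?_ ?_ ?_ ?_
  · rintro ⟨x, a⟩ h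
    simp only [mem_product, Fintype.mem_piFinset] at h ⊢
    refine ⟨fun i => ?_, h.1 p⟩
    by_cases hi : i = p
    · subst hi; simpa using h.2
    · simpa [Function.update_of_ne hi] using h.1 i
  · rintro ⟨x, a⟩ h
    simp only [mem_product, Fintype.mem_piFinset] at h ⊢
    refine ⟨fun i => ?_, h.1 p⟩
    by_cases hi : i = p
    · subst hi; simpa using h.2
    · simpa [Function.update_of_ne hi] using h.1 i
  · rintro ⟨x, a⟩ h; simp
  · rintro ⟨x, a⟩ h; simp
  · rintro ⟨x, a⟩ h; simp

/-- number of pairs of colour `b` between two sets -/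
def brE {α : Type*} (c : α → α → Bool) (b : Bool) (A B : Finset α) : ℕ :=
  #{p ∈ A ×ˢ B | c p.1 p.2 = b}

/-- cut-type regularity -/
def BrCut {α : Type*} (c : α → α → Bool) (b : Bool) (d η : ℝ) (U V : Finset α) : Prop :=
  ∀ A ⊆ U, ∀ B ⊆ V, |(brE c b A B : ℝ) - d * (#A * #B)| ≤ η * (#U * #V)

/-- edge replacement step -/
lemma br_step {k : ℕ} {α : Type*} [DecidableEq α] (c : α → α → Bool) (b : Bool)
    (U A : Fin k → Finset α) (hU : ∀ i, (U i).Nonempty)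
    (E : Finset (Fin k × Fin k)) (hE : ∀ e ∈ E, e.1 < e.2) (p q : Fin k) (hpq : p < q)
    (hnot : (p, q) ∉ E) (d η : ℝ) (hcut : BrCut c b d η (U p) (U q)) :
    |∑ x ∈ Fintype.piFinset U, (if ((∀ i, x i ∈ A i) ∧ ∀ e ∈ E, c (x e.1) (x e.2) = b) then
      ((if c (x p) (x q) = b then (1:ℝ) else 0) - d) else 0)| ≤ η * ∏ i, (#(U i) : ℝ) := by
  set f : (Fin k → α) → ℝ := fun x => (if ((∀ i, x i ∈ A i) ∧ ∀ e ∈ E, c (x e.1) (x e.2) = b) then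
      ((if c (x p) (x q) = b then (1:ℝ) else 0) - d) else 0) with hf
  have hne : p ≠ q := hpq.ne
  have hp : (0:ℝ) < #(U p) := by exact_mod_cast (hU p).card_pos
  have hq : (0:ℝ) < #(U q) := by exact_mod_cast (hU q).card_pos
  have h1 := br_avg1 U p (fun x => ∑ b ∈ U q, f (Function.update x q b))
  rw [br_avg1 U q f] at h1
  have h2 : ∀ x : Fin k → α, |∑ a ∈ U p, ∑ b' ∈ U q, f (Function.update (Function.update x p a) q b')|
      ≤ η * (#(U p) * #(U q)) := by
    intro x
    set A' : Finset α := {a ∈ U p | (∀ i, i ≠ q → Function.update x p a i ∈ A i) ∧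
      ∀ e ∈ E, e.1 ≠ q → e.2 ≠ q → c (Function.update x p a e.1) (Function.update x p a e.2) = b}
      with hA'
    set B' : Finset α := {a ∈ U q | a ∈ A q ∧
      ∀ e ∈ E, (e.1 = q ∨ e.2 = q) → c (Function.update x q a e.1) (Function.update x q a e.2) = b}
      with hB'
    have h3 : ∀ a ∈ U p, ∀ b' ∈ U q, f (Function.update (Function.update x p a) q b') =
        if a ∈ A' ∧ b' ∈ B' then ((if c a b' = b then (1:ℝ) else 0) - d) else 0 := by
      intro a ha b' hb'
      have hy : Function.update (Function.update x p a) q b' p = a := by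
        rw [Function.update_of_ne hne, Function.update_self]
      have hz : Function.update (Function.update x p a) q b' q = b' := by
        rw [Function.update_self]
      simp only [hf, hy, hz]
      have : ((∀ i, Function.update (Function.update x p a) q b' i ∈ A i) ∧
          ∀ e ∈ E, c (Function.update (Function.update x p a) q b' e.1)
            (Function.update (Function.update x p a) q b' e.2) = b) ↔ (a ∈ A' ∧ b' ∈ B') := by
        have k1 : ∀ i, i ≠ q → Function.update (Function.update x p a) q b' i
            = Function.update x p a i := fun i hi => Function.update_of_ne hi _ _
        have k2 : ∀ i, i ≠ p → Function.update (Function.update x p a) q b' i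
            = Function.update x q b' i := by
          intro i hi
          by_cases hiq : i = q
          · subst hiq; simp
          · rw [Function.update_of_ne hiq, Function.update_of_ne hi, Function.update_of_ne hiq]
        have k3 : ∀ e ∈ E, (e.1 = q ∨ e.2 = q) → e.1 ≠ p ∧ e.2 ≠ p := by
          intro e he h
          have hlt := hE e he
          rcases h with h | h
          · rw [h] at hlt ⊢
            exact ⟨hne.symm, fun h' => by rw [h'] at hlt; exact absurd hlt (not_lt.2 hpq.le)⟩
          · refine ⟨fun h' => hnot ?_, by rw [h]; exact hne.symm⟩
            rw [← h', ← h]; exact he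
        simp only [hA', hB', mem_filter, ha, hb', true_and]
        constructor
        · rintro ⟨g1, g2⟩
          refine ⟨⟨fun i hi => ?_, fun e he h1 h2 => ?_⟩, ?_, fun e he h => ?_⟩
          · rw [← k1 i hi]; exact g1 i
          · rw [← k1 _ h1, ← k1 _ h2]; exact g2 e he
          · have := g1 q; rwa [hz] at this
          · rw [← k2 _ (k3 e he h).1, ← k2 _ (k3 e he h).2]; exact g2 e he
        · rintro ⟨⟨g1, g2⟩, g3, g4⟩
          refine ⟨fun i => ?_, fun e he => ?_⟩
          · by_cases hi : i = q
            · subst hi; rw [hz]; exact g3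
            · rw [k1 i hi]; exact g1 i hi
          · by_cases h : e.1 = q ∨ e.2 = q
            · rw [k2 _ (k3 e he h).1, k2 _ (k3 e he h).2]; exact g4 e he h
            · push Not at h
              rw [k1 _ h.1, k1 _ h.2]; exact g2 e he h.1 h.2
      simp only [this]
    have h4 : ∑ a ∈ U p, ∑ b' ∈ U q, f (Function.update (Function.update x p a) q b') =
        (brE c b A' B' : ℝ) - d * (#A' * #B') := by
      rw [sum_congr rfl fun a ha => sum_congr rfl fun b' hb' => h3 a ha b' hb']
      rw [← sum_product' (U p) (U q) (fun a b' => if a ∈ A' ∧ b' ∈ B' then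
        ((if c a b' = b then (1:ℝ) else 0) - d) else 0), ← sum_filter]
      have : {z ∈ U p ×ˢ U q | z.1 ∈ A' ∧ z.2 ∈ B'} = A' ×ˢ B' := by
        ext z
        simp only [mem_filter, mem_product]
        constructor
        · exact fun h => h.2
        · intro h
          exact ⟨⟨(mem_filter.1 h.1).1, (mem_filter.1 h.2).1⟩, h⟩
      rw [this, sum_sub_distrib, sum_boole, sum_const, card_product, brE]
      simp only [nsmul_eq_mul]; push_cast; ring
    rw [h4]
    exact hcut A' (filter_subset _ _) B' (filter_subset _ _)
  have h5 : |(#(U p) : ℝ) * (#(U q) * ∑ x ∈ Fintype.piFinset U, f x)| ≤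
      (∏ i, (#(U i) : ℝ)) * (η * (#(U p) * #(U q))) := by
    rw [← h1]
    refine (abs_sum_le_sum_abs _ _).trans ((sum_le_sum fun x _ => h2 x).trans (le_of_eq ?_))
    rw [sum_const, Fintype.card_piFinset, nsmul_eq_mul]; push_cast; rfl
  rw [← mul_assoc, abs_mul, abs_of_pos (mul_pos hp hq)] at h5
  have : (#(U p) * #(U q) : ℝ) * |∑ x ∈ Fintype.piFinset U, f x| ≤
      (#(U p) * #(U q)) * (η * ∏ i, (#(U i) : ℝ)) := by linarith
  exact le_of_mul_le_mul_left this (mul_pos hp hq)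

/-- transversal tuples -/
def brT {k : ℕ} {α : Type*} [DecidableEq α] (c : α → α → Bool) (b : Bool)
    (U A : Fin k → Finset α) (E : Finset (Fin k × Fin k)) : Finset (Fin k → α) :=
  {x ∈ Fintype.piFinset U | (∀ i, x i ∈ A i) ∧ ∀ e ∈ E, c (x e.1) (x e.2) = b}

lemma br_counting {k : ℕ} {α : Type*} [DecidableEq α] (c : α → α → Bool) (b : Bool)
    (U A : Fin k → Finset α) (hU : ∀ i, (U i).Nonempty) (hA : ∀ i, A i ⊆ U i)
    (d : Fin k × Fin k → ℝ) (hd0 : ∀ e, 0 ≤ d e) (hd1 : ∀ e, d e ≤ 1) (η : ℝ) (hη : 0 ≤ η)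
    (E : Finset (Fin k × Fin k)) :
    (∀ e ∈ E, e.1 < e.2) → (∀ e ∈ E, BrCut c b (d e) η (U e.1) (U e.2)) →
    |(#(brT c b U A E) : ℝ) - (∏ e ∈ E, d e) * ∏ i, (#(A i) : ℝ)| ≤ #E * η * ∏ i, (#(U i) : ℝ) := by
  induction E using Finset.induction_on with
  | empty =>
    intro _ _
    have : brT c b U A ∅ = Fintype.piFinset A := by
      ext x
      simp only [brT, mem_filter, Fintype.mem_piFinset]
      constructor
      · exact fun h => h.2.1
      · exact fun h => ⟨fun i => hA i (h i), h, by simp⟩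
    rw [this, Fintype.card_piFinset]
    simp
  | insert e E he ih =>
    intro h1 h2
    have ih' := ih (fun e' h => h1 e' (mem_insert_of_mem h)) (fun e' h => h2 e' (mem_insert_of_mem h))
    have hs := br_step c b U A hU E (fun e' h => h1 e' (mem_insert_of_mem h)) e.1 e.2
      (h1 e (mem_insert_self _ _)) he (d e) η (h2 e (mem_insert_self _ _))
    rw [← sum_filter, sum_sub_distrib, sum_boole, sum_const, filter_filter] at hs
    have h3 : {x ∈ Fintype.piFinset U | ((∀ i, x i ∈ A i) ∧ ∀ e ∈ E, c (x e.1) (x e.2) = b) ∧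
        c (x e.1) (x e.2) = b} = brT c b U A (insert e E) := by
      ext x
      simp only [brT, mem_filter, mem_insert, forall_eq_or_imp]
      tauto
    have h4 : {x ∈ Fintype.piFinset U | ((∀ i, x i ∈ A i) ∧ ∀ e ∈ E, c (x e.1) (x e.2) = b)} =
      brT c b U A E := rfl
    rw [h3, h4, nsmul_eq_mul] at hs
    rw [prod_insert he, card_insert_of_notMem he]
    have hd := hd0 e
    have hd' := hd1 e
    have h5 : |d e * ((#(brT c b U A E) : ℝ) - (∏ e ∈ E, d e) * ∏ i, (#(A i) : ℝ))| ≤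
        #E * η * ∏ i, (#(U i) : ℝ) := by
      rw [abs_mul, abs_of_nonneg hd]
      calc _ ≤ 1 * |(#(brT c b U A E) : ℝ) - (∏ e ∈ E, d e) * ∏ i, (#(A i) : ℝ)| := by gcongr
        _ ≤ _ := by rw [one_mul]; exact ih'
    have h6 := abs_add_le ((#(brT c b U A (insert e E)) : ℝ) - #(brT c b U A E) * d e)
      (d e * ((#(brT c b U A E) : ℝ) - (∏ e ∈ E, d e) * ∏ i, (#(A i) : ℝ)))
    have h7 : (#(brT c b U A (insert e E)) : ℝ) - #(brT c b U A E) * d e +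
      (d e * ((#(brT c b U A E) : ℝ) - (∏ e ∈ E, d e) * ∏ i, (#(A i) : ℝ))) =
      (#(brT c b U A (insert e E)) : ℝ) - d e * (∏ e ∈ E, d e) * ∏ i, (#(A i) : ℝ) := by ring
    rw [h7] at h6
    push_cast
    linarith

/-- Lemma B -/
lemma br_blue {k : ℕ} {α : Type*} [Fintype α] [DecidableEq α] (c : α → α → Bool)
    (hc : ∀ v w, c v w = c w v) (b : Bool) (P : ℝ) (hP0 : 0 ≤ P) (hPN : P ≤ Fintype.card α)
    (hP : ∀ A : Finset α, #A = k → BrMono c b A → (#(brPages c b A) : ℝ) ≤ P)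
    (U : Fin k → Finset α) (hU : ∀ i, (U i).Nonempty)
    (hdis : ∀ i j, i < j → Disjoint (U i) (U j))
    (d : Fin k × Fin k → ℝ) (δ : ℝ) (hδ : 0 < δ) (hd0 : ∀ e, δ ≤ d e) (hd1 : ∀ e, d e ≤ 1)
    (η : ℝ) (hη : 0 ≤ η)
    (hcut : ∀ i j, i < j → BrCut c b (d (i, j)) η (U i) (U j)) (γ : ℝ)
    (hsmall : 2 * k ^ 2 * η ≤ δ ^ (k ^ 2) * γ) :
    ∑ v : α, ∏ i, ((#{u ∈ U i | c v u = b} : ℝ) / #(U i)) ≤ P + γ * Fintype.card α := by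
  set N : ℝ := (Fintype.card α : ℝ) with hN
  set E : Finset (Fin k × Fin k) := {e | e.1 < e.2} with hE
  have hEmem : ∀ e ∈ E, e.1 < e.2 := by intro e he; simpa [hE] using he
  have hEc : #E ≤ k ^ 2 := by
    refine (card_le_univ _).trans ?_
    simp [sq]
  have hδ1 : ∀ e ∈ E, BrCut c b (d e) η (U e.1) (U e.2) := fun e he => hcut _ _ (hEmem e he)
  set D : ℝ := ∏ e ∈ E, d e with hD
  set M : ℝ := ∏ i, (#(U i) : ℝ) with hM
  have hMpos : 0 < M := prod_pos fun i _ => by exact_mod_cast (hU i).card_pos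
  have hd0' : ∀ e, 0 ≤ d e := fun e => hδ.le.trans (hd0 e)
  have cnt : ∀ A : Fin k → Finset α, (∀ i, A i ⊆ U i) →
      |(#(brT c b U A E) : ℝ) - D * ∏ i, (#(A i) : ℝ)| ≤ k ^ 2 * η * M := by
    intro A hA
    refine (br_counting c b U A hU hA d hd0' hd1 η hη E hEmem hδ1).trans ?_
    gcongr; exact_mod_cast hEc
  -- double counting
  have dc : ∑ v : α, (#(brT c b U (fun i => {u ∈ U i | c v u = b}) E) : ℝ) ≤
      #(brT c b U U E) * P := by
    have h1 : ∀ v : α, (#(brT c b U (fun i => {u ∈ U i | c v u = b}) E) : ℝ) =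
        ∑ x ∈ brT c b U U E, if (∀ i, c v (x i) = b) then (1:ℝ) else 0 := by
      intro v
      rw [sum_boole]
      congr 2
      ext x
      simp only [brT, mem_filter, Fintype.mem_piFinset]
      grind
    rw [sum_congr rfl fun v _ => h1 v, sum_comm, ← nsmul_eq_mul, ← sum_const]
    refine sum_le_sum fun x hx => ?_
    rw [sum_boole]
    simp only [brT, mem_filter, Fintype.mem_piFinset] at hx
    have hinj : Function.Injective x := by
      intro i j hij
      by_contra hne
      rcases lt_or_gt_of_ne hne with h | h
      · exact Finset.disjoint_left.1 (hdis i j h) (hx.1 i) (hij ▸ hx.1 j)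
      · exact Finset.disjoint_left.1 (hdis j i h) (hx.1 j) (hij ▸ hx.1 i)
    have hc1 : #(univ.image x) = k := by
      rw [card_image_of_injective _ hinj]; simp
    have hmono : BrMono c b (univ.image x) := by
      intro v hv w hw hvw
      obtain ⟨i, -, rfl⟩ := mem_image.1 hv
      obtain ⟨j, -, rfl⟩ := mem_image.1 hw
      rcases lt_trichotomy i j with h | h | h
      · exact hx.2.2 (i, j) (by simp [hE, h])
      · exact absurd (congrArg x h) hvw
      · rw [hc]; exact hx.2.2 (j, i) (by simp [hE, h])
    refine le_trans (le_of_eq ?_) (hP _ hc1 hmono)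
    congr 2
    ext v
    simp [brPages]
  have hU' := (abs_le.1 (cnt U fun i => Subset.rfl)).2
  have hlow : ∀ v : α, M * (D * ∏ i, ((#{u ∈ U i | c v u = b} : ℝ) / #(U i)) - k ^ 2 * η) ≤
      (#(brT c b U (fun i => {u ∈ U i | c v u = b}) E) : ℝ) := by
    intro v
    have h1 := (abs_le.1 (cnt (fun i => {u ∈ U i | c v u = b}) fun i => filter_subset _ _)).1
    have h2 : M * ∏ i, ((#{u ∈ U i | c v u = b} : ℝ) / #(U i)) = ∏ i, (#{u ∈ U i | c v u = b} : ℝ) := by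
      rw [prod_div_distrib, mul_div_cancel₀ _ hMpos.ne']
    rw [← h2] at h1
    linarith
  have h1 := (sum_le_sum fun v (_ : v ∈ (univ : Finset α)) => hlow v).trans dc
  have h2 : (#(brT c b U U E) : ℝ) * P ≤ (M * (D + k ^ 2 * η)) * P := by
    gcongr; linarith
  have h3 := h1.trans h2
  rw [← mul_sum, mul_assoc] at h3
  have h4 := le_of_mul_le_mul_left h3 hMpos
  rw [sum_sub_distrib, ← mul_sum, sum_const, nsmul_eq_mul, card_univ, ← hN] at h4
  by_cases hEe : ∃ e : Fin k × Fin k, True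
  swap
  · -- no indices: the bound is still fine
    have hD1 : D = 1 := by
      rw [hD]; apply prod_eq_one; intro e _; exact absurd ⟨e, trivial⟩ hEe
    have hk0 : (k:ℝ) = 0 := by
      rcases Nat.eq_zero_or_pos k with h | h
      · exact_mod_cast h
      · exact absurd ⟨(⟨0, h⟩, ⟨0, h⟩), trivial⟩ hEe
    rw [hD1, hk0] at h4
    rw [hk0] at hsmall
    have hk0' : k = 0 := by exact_mod_cast hk0
    have hg : 0 ≤ γ := by rw [hk0'] at hsmall; norm_num at hsmall; exact hsmall
    have : 0 ≤ γ * N := by positivity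
    linarith
  obtain ⟨e0, -⟩ := hEe
  have hδle : δ ≤ 1 := (hd0 e0).trans (hd1 e0)
  have hDge : δ ^ (k ^ 2) ≤ D := by
    calc δ ^ (k ^ 2) ≤ δ ^ #E := pow_le_pow_of_le_one hδ.le hδle hEc
      _ = ∏ e ∈ E, δ := by simp
      _ ≤ D := prod_le_prod (fun _ _ => hδ.le) fun e _ => hd0 e
  have hDpos : 0 < D := lt_of_lt_of_le (by positivity) hDge
  have hγ : 0 ≤ γ := by
    have h1 : 0 ≤ 2 * k ^ 2 * η := by positivity
    have h2 : 0 < δ ^ (k ^ 2) := by positivity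
    by_contra! h
    have := mul_neg_of_pos_of_neg h2 h
    linarith
  have h5 : k ^ 2 * η * P ≤ k ^ 2 * η * N := by gcongr
  have h6 : 2 * k ^ 2 * η * N ≤ D * γ * N := by
    have : 0 ≤ N := by positivity
    exact mul_le_mul_of_nonneg_right (hsmall.trans (by gcongr)) this
  refine le_of_mul_le_mul_left ?_ hDpos
  linarith

lemma brE_le {α : Type*} (c : α → α → Bool) (b : Bool) (A B : Finset α) :
    brE c b A B ≤ #A * #B := by
  rw [← card_product]; exact card_filter_le _ _

lemma brE_mono {α : Type*} (c : α → α → Bool) (b : Bool) {A B A' B' : Finset α}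
    (hA : A ⊆ A') (hB : B ⊆ B') : brE c b A B ≤ brE c b A' B' :=
  card_le_card (filter_subset_filter _ (product_subset_product hA hB))

lemma brE_add {α : Type*} (c : α → α → Bool) (b : Bool) (A B : Finset α) :
    brE c b A B + brE c (!b) A B = #A * #B := by
  rw [← card_product, brE, brE, ← card_filter_add_card_filter_not (s := A ×ˢ B) (fun p => c p.1 p.2 = b)]
  congr 3
  ext p
  cases c p.1 p.2 <;> cases b <;> simp

/-- the graph of colour `true` -/
def brG {α : Type*} (c : α → α → Bool) (hc : ∀ v w, c v w = c w v) : SimpleGraph α where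
  Adj v w := v ≠ w ∧ c v w = true
  symm := ⟨fun v w h => ⟨h.1.symm, by rw [hc]; exact h.2⟩⟩
  loopless := ⟨fun v h => h.1 rfl⟩

lemma br_bridge {α : Type*} [DecidableEq α] (c : α → α → Bool) (hc : ∀ v w, c v w = c w v)
    [DecidableRel (brG c hc).Adj] (ε : ℝ) (X Y : Finset α) (hXY : Disjoint X Y)
    (hX : X.Nonempty) (hY : Y.Nonempty) (h : (brG c hc).IsUniform ε X Y) (b : Bool) :
    BrCut c b ((brE c b X Y : ℝ) / (#X * #Y)) ε X Y := by
  have hεpos : 0 < ε := h.pos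
  have hXp : (0:ℝ) < #X := by exact_mod_cast hX.card_pos
  have hYp : (0:ℝ) < #Y := by exact_mod_cast hY.card_pos
  have hint : ∀ A ⊆ X, ∀ B ⊆ Y, (((brG c hc).edgeDensity A B : ℚ) : ℝ) =
      (brE c true A B : ℝ) / (#A * #B) := by
    intro A hA B hB
    rw [SimpleGraph.edgeDensity_def, SimpleGraph.interedges_def, brE]
    push_cast
    congr 3
    ext p
    rw [mem_filter, mem_filter, mem_product]
    constructor
    · rintro ⟨h1, -, h2⟩; exact ⟨h1, h2⟩
    · rintro ⟨h1, h2⟩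
      refine ⟨h1, fun he => ?_, h2⟩
      exact Finset.disjoint_left.1 hXY (hA h1.1) (he ▸ hB h1.2)
  have main : BrCut c true ((brE c true X Y : ℝ) / (#X * #Y)) ε X Y := by
    intro A hA B hB
    have hd0 : 0 ≤ (brE c true X Y : ℝ) / (#X * #Y) := by positivity
    have hd1 : (brE c true X Y : ℝ) / (#X * #Y) ≤ 1 := by
      rw [div_le_one (by positivity)]; exact_mod_cast brE_le c true X Y
    set d := (brE c true X Y : ℝ) / (#X * #Y) with hd
    have he1 : (brE c true A B : ℝ) ≤ #A * #B := by exact_mod_cast brE_le c true A B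
    have he0 : (0:ℝ) ≤ brE c true A B := by positivity
    have hAB : (0:ℝ) ≤ #A * #B := by positivity
    have hAX : (#A : ℝ) ≤ #X := by exact_mod_cast card_le_card hA
    have hBY : (#B : ℝ) ≤ #Y := by exact_mod_cast card_le_card hB
    have triv : |(brE c true A B : ℝ) - d * (#A * #B)| ≤ #A * #B := by
      rw [abs_le]
      have := mul_nonneg hd0 hAB
      have := mul_le_of_le_one_left hAB hd1
      constructor <;> linarith
    by_cases h1 : (#X : ℝ) * ε ≤ #A
    · by_cases h2 : (#Y : ℝ) * ε ≤ #B
      · have h3 := h hA hB h1 h2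
        rw [hint A hA B hB, hint X Subset.rfl Y Subset.rfl] at h3
        have hA0 : (0:ℝ) < #A := lt_of_lt_of_le (by positivity) h1
        have hB0 : (0:ℝ) < #B := lt_of_lt_of_le (by positivity) h2
        have h4 : (brE c true A B : ℝ) - d * (#A * #B) =
            ((brE c true A B : ℝ) / (#A * #B) - d) * (#A * #B) := by field_simp
        rw [h4, abs_mul, abs_of_nonneg hAB]
        exact mul_le_mul h3.le (by gcongr) hAB hεpos.le
      · push Not at h2
        refine triv.trans ?_
        calc (#A : ℝ) * #B ≤ #X * (#Y * ε) := by gcongr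
          _ = _ := by ring
    · push Not at h1
      refine triv.trans ?_
      calc (#A : ℝ) * #B ≤ (#X * ε) * #Y := by gcongr
        _ = _ := by ring
  cases b
  · intro A hA B hB
    have h1 := main A hA B hB
    have h2 : (brE c true A B : ℝ) + brE c false A B = #A * #B := by exact_mod_cast brE_add c true A B
    have h3 : (brE c true X Y : ℝ) + brE c false X Y = #X * #Y := by exact_mod_cast brE_add c true X Y
    have h4 : (brE c false X Y : ℝ) / (#X * #Y) = 1 - (brE c true X Y : ℝ) / (#X * #Y) := by
      rw [← h3]
      have : (0:ℝ) < (brE c true X Y : ℝ) + brE c false X Y := by rw [h3]; positivity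
      field_simp; ring
    rw [h4, ← abs_neg]
    refine le_trans (le_of_eq ?_) h1
    congr 1
    linarith
  · exact main

lemma br_regular (ε : ℝ) (hε : 0 < ε) (l : ℕ) : ∃ L : ℕ, ∀ (N : ℕ) (c : Fin N → Fin N → Bool),
    (∀ v w, c v w = c w v) → l ≤ N → ∃ (PP : Finset (Finset (Fin N)))
      (good : Finset (Fin N) → Finset (Fin N) → Prop),
      l ≤ #PP ∧ #PP ≤ L ∧ (∀ X ∈ PP, ∀ Y ∈ PP, X ≠ Y → Disjoint X Y) ∧
      (∀ X ∈ PP, X.Nonempty ∧ N / #PP ≤ #X) ∧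
      (∀ X ∈ PP, ∀ Y ∈ PP, X ≠ Y → good X Y →
        ∀ b, BrCut c b ((brE c b X Y : ℝ) / (#X * #Y)) ε X Y) ∧
      (∀ B : Finset (Finset (Fin N) × Finset (Fin N)),
        (∀ p ∈ B, p.1 ∈ PP ∧ p.2 ∈ PP ∧ p.1 ≠ p.2 ∧ ¬ good p.1 p.2) → (#B : ℝ) ≤ ε * #PP ^ 2) := by
  classical
  refine ⟨SzemerediRegularity.bound ε l, fun N c hc hl => ?_⟩
  obtain ⟨P, h1, h2, h3, h4⟩ := szemeredi_regularity (brG c hc) hε (l := l) (by simpa using hl)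
  refine ⟨P.parts, fun X Y => (brG c hc).IsUniform ε X Y, h2, h3,
    fun X hX Y hY h => P.disjoint hX hY h, fun X hX => ⟨P.nonempty_of_mem_parts hX, ?_⟩,
    fun X hX Y hY h hg b => br_bridge c hc ε X Y (P.disjoint hX hY h) (P.nonempty_of_mem_parts hX)
      (P.nonempty_of_mem_parts hY) hg b, fun B hB => ?_⟩
  · have := h1.average_le_card_part hX
    simpa using this
  · have h5 : B ⊆ P.nonUniforms (brG c hc) ε := by
      rintro ⟨X, Y⟩ hp
      rw [Finpartition.mk_mem_nonUniforms]
      exact hB _ hp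
    have h6 : (#B : ℝ) ≤ #(P.nonUniforms (brG c hc) ε) := by exact_mod_cast card_le_card h5
    refine h6.trans (h4.trans ?_)
    rw [mul_comm]
    gcongr
    rw [sq]
    push_cast
    gcongr
    exact_mod_cast Nat.sub_le _ _

lemma br_sel {ι : Type*} [DecidableEq ι] (PP : Finset ι) (β : ι → Bool) (good : ι → ι → Prop)
    (ε τ : ℝ) (hτ : 0 < τ) (hετ : ε ≤ τ ^ 2) (h0 : PP.Nonempty)
    (hB : ∀ B : Finset (ι × ι),
        (∀ p ∈ B, p.1 ∈ PP ∧ p.2 ∈ PP ∧ p.1 ≠ p.2 ∧ ¬ good p.1 p.2) → (#B : ℝ) ≤ ε * #PP ^ 2) :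
    ∃ (b : Bool) (I : Finset ι), I ⊆ PP ∧ (∀ X ∈ I, β X = b) ∧ (1 / 2 - τ) * #PP ≤ #I ∧
      ∀ X ∈ I, ∀ Z : Finset ι, (∀ Y ∈ Z, Y ∈ PP ∧ X ≠ Y ∧ ¬ good X Y) → (#Z : ℝ) ≤ τ * #PP := by
  classical
  have hM : (0:ℝ) < #PP := by exact_mod_cast h0.card_pos
  set nb : ι → Finset ι := fun X => {Y ∈ PP | X ≠ Y ∧ ¬ good X Y} with hnb
  set bad : Finset ι := {X ∈ PP | τ * #PP < #(nb X)} with hbad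
  have hbadc : (#bad : ℝ) ≤ τ * #PP := by
    have h1 := hB (bad.sigma nb |>.image fun p => (p.1, p.2)) (by
      intro p hp
      obtain ⟨⟨X, Y⟩, hq, rfl⟩ := mem_image.1 hp
      rw [mem_sigma] at hq
      have h1 := (mem_filter.1 hq.1).1
      have h2 := mem_filter.1 hq.2
      exact ⟨h1, h2.1, h2.2.1, h2.2.2⟩)
    rw [card_image_of_injective _ (by rintro ⟨a, b⟩ ⟨c, d⟩ h; simpa using h), card_sigma] at h1
    push_cast at h1
    have h2 : (#bad : ℝ) * (τ * #PP) ≤ ∑ X ∈ bad, (#(nb X) : ℝ) := by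
      rw [← nsmul_eq_mul, ← sum_const]
      exact sum_le_sum fun X hX => (mem_filter.1 hX).2.le
    have h3 : ε * (#PP : ℝ) ^ 2 ≤ τ ^ 2 * (#PP : ℝ) ^ 2 := by gcongr
    refine le_of_mul_le_mul_right ?_ (mul_pos hτ hM)
    linarith
  have hmaj : ∃ b, (1 / 2 : ℝ) * #PP ≤ #{X ∈ PP | β X = b} := by
    by_contra! h
    have h1 := h true
    have h2 := h false
    have h3 := card_filter_add_card_filter_not (s := PP) (fun X => β X = true)
    simp only [Bool.not_eq_true] at h3
    have h4 : (#{X ∈ PP | β X = true} : ℝ) + #{X ∈ PP | β X = false} = #PP := by exact_mod_cast h3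
    linarith
  obtain ⟨b, hb⟩ := hmaj
  refine ⟨b, {X ∈ PP | β X = b} \ bad, sdiff_subset.trans (filter_subset _ _),
    fun X hX => (mem_filter.1 (mem_sdiff.1 hX).1).2, ?_, ?_⟩
  · have := le_card_sdiff bad {X ∈ PP | β X = b}
    have h2 : #{X ∈ PP | β X = b} ≤ #({X ∈ PP | β X = b} \ bad) + #bad := by omega
    have h3 : (#{X ∈ PP | β X = b} : ℝ) ≤ #({X ∈ PP | β X = b} \ bad) + #bad := by exact_mod_cast h2
    linarith
  · intro X hX Z hZ
    have hX1 := mem_sdiff.1 hX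
    have h1 : ¬ (τ * #PP < #(nb X)) := fun h => hX1.2 (mem_filter.2 ⟨(mem_filter.1 hX1.1).1, h⟩)
    push Not at h1
    refine le_trans ?_ h1
    exact_mod_cast card_le_card fun Y hY => mem_filter.2 ⟨(hZ Y hY).1, (hZ Y hY).2⟩

lemma br_case2 {α : Type*} [Fintype α] [DecidableEq α] (c : α → α → Bool)
    (b : Bool) (k : ℕ) (hc : ∀ v w, c v w = c w v) (U X : Finset α)
    (hUX : U ⊆ X) (hU : U.Nonempty) (hX : #X ≤ 3 * #U) (δ : ℝ) (hδ : 0 ≤ δ)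
    (Z : Finset (Finset α)) (hZ : ∀ Y ∈ Z, ∀ Y' ∈ Z, Y ≠ Y' → Disjoint Y Y')
    (hE : ∀ Y ∈ Z, (brE c (!b) X Y : ℝ) ≤ δ * (#X * #Y)) :
    (1 - 3 * k * δ) * ∑ Y ∈ Z, (#Y : ℝ) ≤ ∑ v : α, ((#{u ∈ U | c v u = b} : ℝ) / #U) ^ k := by
  have hUp : (0:ℝ) < #U := by exact_mod_cast hU.card_pos
  have hX' : (#X : ℝ) ≤ 3 * #U := by exact_mod_cast hX
  set x : α → ℝ := fun v => (#{u ∈ U | c v u = b} : ℝ) / #U with hx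
  have hx0 : ∀ v, 0 ≤ x v := fun v => by positivity
  have hneg : ∀ v, 1 - x v = (#{u ∈ U | c v u = !b} : ℝ) / #U := by
    intro v
    have h3 := card_filter_add_card_filter_not (s := U) (fun u => c v u = b)
    have h4 : {u ∈ U | ¬ c v u = b} = {u ∈ U | c v u = !b} := by
      ext u; cases c v u <;> cases b <;> simp
    rw [h4] at h3
    have h5 : (#{u ∈ U | c v u = b} : ℝ) + #{u ∈ U | c v u = !b} = #U := by exact_mod_cast h3
    simp only [hx]
    rw [eq_div_iff hUp.ne', sub_mul, div_mul_cancel₀ _ hUp.ne']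
    linarith
  have hY : ∀ Y ∈ Z, (1 - 3 * k * δ) * (#Y : ℝ) ≤ ∑ v ∈ Y, x v ^ k := by
    intro Y hY
    have h1 : ∑ v ∈ Y, (1 - x v) = (brE c (!b) U Y : ℝ) / #U := by
      rw [sum_congr rfl fun v _ => hneg v, ← sum_div]
      congr 1
      rw [brE, card_filter, sum_product_right]
      push_cast
      refine sum_congr rfl fun v _ => ?_
      rw [card_filter]
      push_cast
      refine sum_congr rfl fun u _ => ?_
      rw [hc]
    have h2 : (brE c (!b) U Y : ℝ) / #U ≤ 3 * δ * #Y := by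
      rw [div_le_iff₀ hUp]
      have : (brE c (!b) U Y : ℝ) ≤ brE c (!b) X Y := by exact_mod_cast brE_mono c (!b) hUX Subset.rfl
      refine this.trans ((hE Y hY).trans ?_)
      calc δ * ((#X : ℝ) * #Y) ≤ δ * ((3 * #U) * #Y) := by gcongr
        _ = _ := by ring
    have h3 : ∑ v ∈ Y, (1 - k * (1 - x v)) ≤ ∑ v ∈ Y, x v ^ k := by
      refine sum_le_sum fun v _ => ?_
      have := one_add_mul_le_pow (a := x v - 1) (by linarith [hx0 v]) k
      have e : 1 + (x v - 1) = x v := by ring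
      rw [e] at this
      linarith
    refine le_trans ?_ h3
    rw [sum_sub_distrib, ← mul_sum, h1]
    have h4 : (k:ℝ) * ((brE c (!b) U Y : ℝ) / #U) ≤ k * (3 * δ * #Y) := by gcongr
    simp only [sum_const, nsmul_eq_mul, mul_one]
    linarith
  rw [mul_sum]
  refine (sum_le_sum hY).trans ?_
  have hbu := sum_biUnion (t := id) (s := Z) (f := fun v => x v ^ k)
    (fun Y hY Y' hY' h => hZ Y hY Y' hY' h)
  simp only [id] at hbu
  rw [← hbu]
  exact sum_le_sum_of_subset_of_nonneg (subset_univ _) fun v _ _ => by have := hx0 v; positivity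

lemma br_case1 {α : Type*} [Fintype α] [DecidableEq α] (c : α → α → Bool)
    (hc : ∀ v w, c v w = c w v) (k s : ℕ) (hk : 1 ≤ k) (hks : k ≤ s) (b : Bool)
    (P : ℝ) (hP0 : 0 ≤ P) (hPN : P ≤ Fintype.card α)
    (hP : ∀ b, ∀ A : Finset α, #A = k → BrMono c b A → (#(brPages c b A) : ℝ) ≤ P)
    (F : Fin k → Finset (Finset α)) (hF : ∀ i, ∀ Q ∈ F i, #Q = s ∧ BrMono c b Q)
    (hd : ∀ i, ∀ Q ∈ F i, ∀ Q' ∈ F i, Q ≠ Q' → Disjoint Q Q') (hne : ∀ i, (F i).Nonempty)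
    (hU : ∀ i, ((F i).biUnion id).Nonempty)
    (hdis : ∀ i j, i < j → Disjoint ((F i).biUnion id) ((F j).biUnion id))
    (d : Fin k × Fin k → ℝ) (δ : ℝ) (hδ : 0 < δ) (hd0 : ∀ e, δ ≤ d e) (hd1 : ∀ e, d e ≤ 1)
    (η : ℝ) (hη : 0 ≤ η)
    (hcut : ∀ i j, i < j → BrCut c (!b) (d (i, j)) η ((F i).biUnion id) ((F j).biUnion id)) (γ : ℝ)
    (hsmall : 2 * k ^ 2 * η ≤ δ ^ (k ^ 2) * γ) :
    2 / 2 ^ k * (Fintype.card α : ℝ) ≤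
      (P + γ * Fintype.card α) + (P + k ^ 2 / s * Fintype.card α) := by
  set U : Fin k → Finset α := fun i => (F i).biUnion id with hUdef
  have hB := br_blue c hc (!b) P hP0 hPN (hP (!b)) U hU hdis d δ hδ hd0 hd1 η hη hcut γ hsmall
  have hR := fun i => br_red c k s hk hks b P (hP b) (F i) (hF i) (hd i) (hne i)
  have hUp : ∀ i, (0:ℝ) < #(U i) := fun i => by exact_mod_cast (hU i).card_pos
  have hneg : ∀ v i, 1 - (#{u ∈ U i | c v u = !b} : ℝ) / #(U i) = (#{u ∈ U i | c v u = b} : ℝ) / #(U i) := by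
    intro v i
    have h3 := card_filter_add_card_filter_not (s := U i) (fun u => c v u = b)
    have h4 : {u ∈ U i | ¬ c v u = b} = {u ∈ U i | c v u = !b} := by
      ext u; cases c v u <;> cases b <;> simp
    rw [h4] at h3
    have h5 : (#{u ∈ U i | c v u = b} : ℝ) + #{u ∈ U i | c v u = !b} = #(U i) := by exact_mod_cast h3
    rw [eq_div_iff (hUp i).ne', sub_mul, div_mul_cancel₀ _ (hUp i).ne']
    linarith
  have hkey : ∀ v : α, (2:ℝ) / 2 ^ k ≤ ∏ i, ((#{u ∈ U i | c v u = !b} : ℝ) / #(U i)) +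
      (∑ i, ((#{u ∈ U i | c v u = b} : ℝ) / #(U i)) ^ k) / k := by
    intro v
    have := br_key k hk (fun i => (#{u ∈ U i | c v u = !b} : ℝ) / #(U i)) (fun i => by positivity)
      (fun i => by
        rw [div_le_one (hUp i)]
        exact_mod_cast card_filter_le _ _)
    simpa only [hneg] using this
  have hs := sum_le_sum fun v (_ : v ∈ (univ : Finset α)) => hkey v
  rw [sum_add_distrib, sum_const, nsmul_eq_mul, card_univ, ← sum_div univ (fun v : α => ∑ i, ((#{u ∈ U i | c v u = b} : ℝ) / #(U i)) ^ k), sum_comm] at hs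
  have hkp : (0:ℝ) < k := by exact_mod_cast hk
  have h2 : (∑ i, ∑ v : α, ((#{u ∈ U i | c v u = b} : ℝ) / #(U i)) ^ k) / k ≤
      P + k ^ 2 / s * Fintype.card α := by
    rw [div_le_iff₀ hkp]
    refine (sum_le_sum fun i _ => hR i).trans (le_of_eq ?_)
    simp only [sum_const, nsmul_eq_mul, card_univ, Fintype.card_fin]
    ring
  linarith

set_option maxHeartbeats 4000000 in
lemma br_main (k : ℕ) (hk : 1 ≤ k) (γ : ℝ) (hγ : 0 < γ) (hγ1 : γ ≤ 1 / 2 ^ k) :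
    ∃ N0 : ℕ, ∀ N : ℕ, N0 ≤ N → ∀ c : Fin N → Fin N → Bool, (∀ v w, c v w = c w v) →
      ∃ (b : Bool) (A : Finset (Fin N)), #A = k ∧ BrMono c b A ∧
        (1 / 2 ^ k - γ) * (N : ℝ) ≤ #(brPages c b A) := by
  classical
  have hkp : (1:ℝ) ≤ k := by exact_mod_cast hk
  have hk0 : (0:ℝ) < k := by linarith
  obtain ⟨s1, hs1⟩ := exists_nat_ge (4 * (k:ℝ) ^ 2 / γ)
  set s : ℕ := max k s1 with hs
  have hks : k ≤ s := le_max_left _ _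
  have hs0 : (0:ℝ) < s := by
    have : 0 < s := by omega
    exact_mod_cast this
  have hsγ : (k:ℝ) ^ 2 / s ≤ γ / 4 := by
    have h1 : (s1:ℝ) ≤ s := by exact_mod_cast le_max_right _ _
    have h2 := hs1.trans h1
    rw [div_le_iff₀ hγ] at h2
    rw [div_le_iff₀ hs0]
    linarith
  set δ : ℝ := 1 / (12 * k) with hδ
  set τ : ℝ := 1 / (50 * k) with hτ
  have hδp : 0 < δ := by positivity
  have hδ1 : δ ≤ 1 := by
    rw [hδ, div_le_one (by positivity)]; linarith
  have hτp : 0 < τ := by positivity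
  have hδk : k * δ = 1 / 12 := by rw [hδ]; field_simp
  have hτk : k * τ = 1 / 50 := by rw [hτ]; field_simp
  set ε : ℝ := min (τ ^ 2) (δ ^ (k ^ 2) * (γ / 4) / (18 * k ^ 2)) with hε
  have hεp : 0 < ε := by rw [hε]; exact lt_min (by positivity) (by positivity)
  have hετ : ε ≤ τ ^ 2 := min_le_left _ _
  have hsmall : 2 * (k:ℝ) ^ 2 * (9 * ε) ≤ δ ^ (k ^ 2) * (γ / 4) := by
    have h1 : ε ≤ δ ^ (k ^ 2) * (γ / 4) / (18 * k ^ 2) := min_le_right _ _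
    rw [le_div_iff₀ (by positivity)] at h1
    linarith
  obtain ⟨L, hL⟩ := br_regular ε hεp (50 * k)
  refine ⟨50 * k + (L + 1) * (3 * 4 ^ s + 10), fun N hN c hc => ?_⟩
  obtain ⟨PP, good, hl, hPL, hdisj, hpart, hcut, hbad⟩ := hL N c hc (by omega)
  set M : ℕ := #PP with hM
  have hM0 : 0 < M := by omega
  have hMR : (0:ℝ) < M := by exact_mod_cast hM0
  have hNM : M * (3 * 4 ^ s + 10) ≤ N := by
    have : M * (3 * 4 ^ s + 10) ≤ (L + 1) * (3 * 4 ^ s + 10) := Nat.mul_le_mul_right _ (by omega)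
    omega
  have hNM1 : M * (3 * 4 ^ s) ≤ N := by rw [mul_add] at hNM; omega
  have hNM2 : M * 10 ≤ N := by rw [mul_add] at hNM; omega
  have hNMR : (M:ℝ) * 10 ≤ N := by exact_mod_cast hNM2
  have hNpos : (0:ℝ) < N := by linarith
  have hτM : 1 ≤ τ * M := by
    have : (50 * k : ℝ) ≤ M := by exact_mod_cast hl
    rw [hτ, one_div, ← div_eq_inv_mul, le_div_iff₀ (by positivity)]
    linarith
  have hsize : ∀ X ∈ PP, 9 / 10 * (N:ℝ) ≤ #X * M := by
    intro X hX
    have h1 := (hpart X hX).2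
    have h2 : N < (N / M) * M + M := Nat.lt_div_mul_add hM0
    have h3 : (N / M) * M ≤ #X * M := Nat.mul_le_mul_right _ h1
    have h4 : (N:ℝ) ≤ #X * M + M := by
      have : N ≤ #X * M + M := by omega
      exact_mod_cast this
    linarith
  by_contra hcon
  push Not at hcon
  set P : ℝ := (1 / 2 ^ k - γ) * N with hPdef
  have hP : ∀ b, ∀ A : Finset (Fin N), #A = k → BrMono c b A → (#(brPages c b A) : ℝ) ≤ P :=
    fun b A h1 h2 => (hcon b A h1 h2).le
  have hP0 : 0 ≤ P := mul_nonneg (by linarith) hNpos.le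
  have h2k : (1:ℝ) / 2 ^ k ≤ 1 := by
    rw [div_le_one (by positivity)]
    exact one_le_pow₀ (by norm_num)
  have hPN : P ≤ Fintype.card (Fin N) := by
    rw [Fintype.card_fin, hPdef]
    exact mul_le_of_le_one_left hNpos.le (by linarith)
  have hpick : ∀ X : Finset (Fin N), ∃ b, ∃ F : Finset (Finset (Fin N)), X ∈ PP →
      (∀ Q ∈ F, Q ⊆ X ∧ #Q = s ∧ BrMono c b Q) ∧
      (∀ Q ∈ F, ∀ Q' ∈ F, Q ≠ Q' → Disjoint Q Q') ∧ #X ≤ 3 * (s * #F) := by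
    intro X
    by_cases hX : X ∈ PP
    · have h1 : 3 * 4 ^ s ≤ #X := by
        refine le_trans ?_ (hpart X hX).2
        rw [Nat.le_div_iff_mul_le hM0]; linarith
      obtain ⟨b, F, h⟩ := br_pick c hc s (by omega) X h1
      exact ⟨b, F, fun _ => h⟩
    · exact ⟨true, ∅, fun h => absurd h hX⟩
  choose β F hF using hpick
  set U : Finset (Fin N) → Finset (Fin N) := fun X => (F X).biUnion id with hUdef
  have hUc : ∀ X ∈ PP, #X ≤ 3 * #(U X) := by
    intro X hX
    obtain ⟨h1, h2, h3⟩ := hF X hX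
    have h4 : #(U X) = s * #(F X) := by
      simp only [hUdef]
      rw [card_biUnion (t := id) (fun Q hQ Q' hQ' h => h2 Q hQ Q' hQ' h)]
      have : ∑ u ∈ F X, #(id u) = ∑ u ∈ F X, s := sum_congr rfl fun Q hQ => (h1 Q hQ).2.1
      rw [this, sum_const, smul_eq_mul, mul_comm]
    rw [h4]; exact h3
  have hUs : ∀ X ∈ PP, U X ⊆ X := by
    intro X hX v hv
    obtain ⟨Q, hQ, hvQ⟩ := mem_biUnion.1 hv
    exact ((hF X hX).1 Q hQ).1 hvQ
  have hUne : ∀ X ∈ PP, (U X).Nonempty := by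
    intro X hX
    have := (hpart X hX).1.card_pos
    have := hUc X hX
    exact card_pos.1 (by omega)
  have hFne : ∀ X ∈ PP, (F X).Nonempty := by
    intro X hX
    obtain ⟨v, hv⟩ := hUne X hX
    obtain ⟨Q, hQ, -⟩ := mem_biUnion.1 hv
    exact ⟨Q, hQ⟩
  obtain ⟨b, I, hIP, hIb, hIc, hIr⟩ := br_sel PP β good ε τ hτp hετ (card_pos.1 hM0) hbad
  have hτ50 : τ ≤ 1 / 50 := by
    rw [← hτk]; exact le_mul_of_one_le_left hτp.le hkp
  have hIpos : (0:ℝ) < #I := lt_of_lt_of_le (mul_pos (by linarith) hMR) hIc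
  have hIne : I.Nonempty := card_pos.1 (by exact_mod_cast hIpos)
  have hFI : ∀ X ∈ I, ∀ Q ∈ F X, #Q = s ∧ BrMono c b Q := by
    intro X hX Q hQ
    have := ((hF X (hIP hX)).1 Q hQ).2
    rwa [hIb X hX] at this
  set H : Finset (Fin N) → Finset (Fin N) → Prop := fun X Y => X ≠ Y ∧ good X Y ∧
    δ * (#X * #Y) ≤ (brE c (!b) X Y : ℝ) with hH
  by_cases hT : ∀ X ∈ I, (k - 1) * #{Y ∈ I | ¬ H X Y} < #I
  · obtain ⟨f, hfI, hfH⟩ := br_turan H I hIne k hT k le_rfl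
    have hfP : ∀ i, f i ∈ PP := fun i => hIP (hfI i)
    set d : Fin k × Fin k → ℝ := fun e => if e.1 < e.2 then
      (brE c (!b) (f e.1) (f e.2) : ℝ) / (#(f e.1) * #(f e.2)) else 1 with hd
    have hfp : ∀ i, (0:ℝ) < #(f i) := fun i => by exact_mod_cast (hpart _ (hfP i)).1.card_pos
    have hd0 : ∀ e, δ ≤ d e := by
      intro e
      simp only [hd]
      split_ifs with h
      · rw [le_div_iff₀ (mul_pos (hfp _) (hfp _))]
        exact (hfH _ _ h).2.2
      · exact hδ1
    have hd1 : ∀ e, d e ≤ 1 := by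
      intro e
      simp only [hd]
      split_ifs with h
      · rw [div_le_one (mul_pos (hfp _) (hfp _))]
        exact_mod_cast brE_le _ _ _ _
      · exact le_rfl
    have key := br_case1 c hc k s hk hks b P hP0 hPN hP (fun i => F (f i))
      (fun i => hFI _ (hfI i)) (fun i => (hF _ (hfP i)).2.1) (fun i => hFne _ (hfP i))
      (fun i => hUne _ (hfP i))
      (fun i j hij => disjoint_of_subset_left (hUs _ (hfP i)) (disjoint_of_subset_right (hUs _ (hfP j))
        (hdisj _ (hfP i) _ (hfP j) (hfH i j hij).1))) d δ hδp hd0 hd1 (9 * ε) (by positivity)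
      (by
        intro i j hij A hA B hB
        have h1 := hcut _ (hfP i) _ (hfP j) (hfH i j hij).1 (hfH i j hij).2.1 (!b) A
          (hA.trans (hUs _ (hfP i))) B (hB.trans (hUs _ (hfP j)))
        have h2 : d (i, j) = (brE c (!b) (f i) (f j) : ℝ) / (#(f i) * #(f j)) := by
          simp only [hd, hij, if_true]
        rw [h2]
        refine h1.trans ?_
        have h3 : (#(f i) : ℝ) ≤ 3 * #(U (f i)) := by exact_mod_cast hUc _ (hfP i)
        have h4 : (#(f j) : ℝ) ≤ 3 * #(U (f j)) := by exact_mod_cast hUc _ (hfP j)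
        calc ε * ((#(f i) : ℝ) * #(f j)) ≤ ε * ((3 * #(U (f i))) * (3 * #(U (f j)))) := by gcongr
          _ = 9 * ε * (#(U (f i)) * #(U (f j))) := by ring) (γ / 4) hsmall
    rw [Fintype.card_fin] at key
    have h1 : (k:ℝ) ^ 2 / s * N ≤ γ / 4 * N := by gcongr
    have h2 : 0 < γ * N := by positivity
    have h3 : 2 / 2 ^ k * (N:ℝ) = 2 * (1 / 2 ^ k * N) := by ring
    have h4 : P = 1 / 2 ^ k * N - γ * N := by rw [hPdef]; ring
    rw [h3, h4] at key
    linarith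
  · push Not at hT
    obtain ⟨X, hXI, hX⟩ := hT
    have hXP := hIP hXI
    set Z : Finset (Finset (Fin N)) := {Y ∈ I | X ≠ Y ∧ good X Y ∧ ¬ (δ * (#X * #Y) ≤ (brE c (!b) X Y : ℝ))}
      with hZ
    set R : Finset (Finset (Fin N)) := {Y ∈ I | X ≠ Y ∧ ¬ good X Y} with hR
    have hRc : (#R : ℝ) ≤ τ * M := hIr X hXI R fun Y hY => by
      have := mem_filter.1 hY
      exact ⟨hIP this.1, this.2⟩
    have hsub : {Y ∈ I | ¬ H X Y} ⊆ insert X (R ∪ Z) := by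
      intro Y hY
      simp only [hH, hR, hZ, mem_filter, mem_insert, mem_union] at hY ⊢
      by_cases h1 : X = Y
      · exact Or.inl h1.symm
      · by_cases h2 : good X Y <;> tauto
    have hc1 : #{Y ∈ I | ¬ H X Y} ≤ #R + #Z + 1 :=
      (card_le_card hsub).trans ((card_insert_le _ _).trans (by
        have := card_union_le R Z; omega))
    have hk2 : 2 ≤ k := by
      by_contra h
      have : k - 1 = 0 := by omega
      rw [this] at hX
      have := hIne.card_pos
      omega
    have hc2 : (#I : ℝ) ≤ (k - 1) * (#R + #Z + 1) := by
      have h1 : #I ≤ (k - 1) * (#R + #Z + 1) := hX.trans (Nat.mul_le_mul_left _ hc1)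
      have h2 : ((k - 1 : ℕ) : ℝ) = k - 1 := by push_cast [Nat.cast_sub hk]; ring
      rw [← h2]
      exact_mod_cast h1
    have hk1 : (0:ℝ) ≤ k - 1 := by linarith
    have hc3 : (44 / 100 : ℝ) * M ≤ (k - 1) * #Z := by
      have h1 : ((k:ℝ) - 1) * (#R + 1) ≤ (k - 1) * (2 * (τ * M)) := by
        gcongr; linarith
      have h2 : ((k:ℝ) - 1) * (2 * (τ * M)) ≤ k * (2 * (τ * M)) := by gcongr; linarith
      have h3 : k * (2 * (τ * M)) = 2 / 50 * (M:ℝ) := by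
        calc k * (2 * (τ * M)) = 2 * (k * τ) * (M:ℝ) := by ring
          _ = _ := by rw [hτk]; ring
      have h4 : (1 / 2 - 1 / 50 : ℝ) * M ≤ (1 / 2 - τ) * M := by gcongr
      have h5 : ((k:ℝ) - 1) * (#R + #Z + 1) = (k - 1) * (#R + 1) + (k - 1) * #Z := by ring
      linarith
    have hW : (9 / 10 * N : ℝ) * #Z ≤ (∑ Y ∈ Z, (#Y : ℝ)) * M := by
      rw [sum_mul, mul_comm, ← nsmul_eq_mul, ← sum_const]
      exact sum_le_sum fun Y hY => hsize Y (hIP (mem_filter.1 hY).1)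
    have h2 := br_case2 c b k hc (U X) X (hUs X hXP) (hUne X hXP) (hUc X hXP) δ hδp.le Z
      (fun Y hY Y' hY' h => hdisj Y (hIP (mem_filter.1 hY).1) Y' (hIP (mem_filter.1 hY').1) h)
      (fun Y hY => (not_le.1 (mem_filter.1 hY).2.2.2).le)
    have h3 := h2.trans (br_red c k s hk hks b P (hP b) (F X) (hFI X hXI) (hF X hXP).2.1 (hFne X hXP))
    rw [Fintype.card_fin] at h3
    have e1 : 1 - 3 * k * δ = 3 / 4 := by
      have : 3 * k * δ = 3 * (k * δ) := by ring
      rw [this, hδk]; norm_num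
    rw [e1] at h3
    have h4 : (k:ℝ) ^ 2 / s * N ≤ γ / 4 * N := by gcongr
    have h5 : 0 < γ * N := by positivity
    have h6 : P = 1 / 2 ^ k * N - γ * N := by rw [hPdef]; ring
    have h7 : 3 / 4 * ∑ Y ∈ Z, (#Y : ℝ) ≤ 1 / 2 ^ k * N := by linarith
    have h8 : ((k:ℝ) - 1) * (1 / 2 ^ k) ≤ 1 / 4 := by
      have : ∀ j : ℕ, (j + 1) * 4 ≤ 2 ^ (j + 2) := by
        intro j
        have := Nat.lt_two_pow_self (n := j)
        rw [pow_add]; omega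
      have h := this (k - 2)
      rw [show k - 2 + 1 = k - 1 by omega, show k - 2 + 2 = k by omega] at h
      have h' : (((k - 1 : ℕ) : ℝ)) * 4 ≤ 2 ^ k := by exact_mod_cast h
      rw [Nat.cast_sub hk] at h'
      push_cast at h'
      rw [mul_one_div, div_le_iff₀ (by positivity)]
      linarith
    set W : ℝ := ∑ Y ∈ Z, (#Y : ℝ) with hWdef
    have h9 : (k - 1) * W ≤ 1 / 3 * N := by
      have a1 : (k - 1) * (3 / 4 * W) ≤ (k - 1) * (1 / 2 ^ k * N) := by gcongr
      have a2 : ((k:ℝ) - 1) * (1 / 2 ^ k * N) = ((k:ℝ) - 1) * (1 / 2 ^ k) * N := by ring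
      have a3 : ((k:ℝ) - 1) * (1 / 2 ^ k) * N ≤ 1 / 4 * N := by gcongr
      linarith
    have h10 : (9 / 10 * N : ℝ) * (44 / 100 * M) ≤ (k - 1) * W * M := by
      calc (9 / 10 * N : ℝ) * (44 / 100 * M) ≤ (9 / 10 * N) * ((k - 1) * #Z) := by gcongr
        _ = (k - 1) * ((9 / 10 * N) * #Z) := by ring
        _ ≤ (k - 1) * (W * M) := by gcongr
        _ = _ := by ring
    have h11 : (k - 1) * W * M ≤ 1 / 3 * N * M := by gcongr
    have h12 : 0 < (N:ℝ) * M := by positivity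
    linarith

lemma br_upper (t : ℕ) (ht : 1 ≤ t) (ε : ℝ) (hε : 0 < ε) :
    ∃ m₀ : ℕ, ∀ m : ℕ, m₀ ≤ m → ∀ c : Fin ⌊((2:ℝ) ^ t + ε) * m⌋₊ → Fin ⌊((2:ℝ) ^ t + ε) * m⌋₊ → Bool,
      (∀ v w, c v w = c w v) → HasMonoBook ⌊((2:ℝ) ^ t + ε) * m⌋₊ t m c := by
  set T : ℝ := 2 ^ t with hT
  have hTp : 0 < T := by positivity
  have hT1 : 1 ≤ T := one_le_pow₀ (by norm_num)
  set γ : ℝ := min (1 / T) (ε / (2 * T * (T + ε))) with hγ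
  have hγp : 0 < γ := lt_min (by positivity) (by positivity)
  have hγ2 : γ * (T + ε) ≤ ε / (2 * T) := by
    have h1 : γ ≤ ε / (2 * T * (T + ε)) := min_le_right _ _
    calc γ * (T + ε) ≤ ε / (2 * T * (T + ε)) * (T + ε) := by gcongr
      _ = _ := by field_simp
  obtain ⟨N0, hN0⟩ := br_main t ht γ hγp (min_le_left _ _)
  obtain ⟨m1, hm1⟩ := exists_nat_ge ((t + 1) / (ε / (2 * T)))
  refine ⟨max N0 m1, fun m hm c hc => ?_⟩
  have hmN0 : N0 ≤ m := (le_max_left _ _).trans hm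
  have hmm1 : (t + 1 : ℝ) ≤ ε / (2 * T) * m := by
    have h1 : (m1:ℝ) ≤ m := by exact_mod_cast (le_max_right _ _).trans hm
    have h2 := hm1.trans h1
    rw [div_le_iff₀ (by positivity)] at h2
    linarith
  have hNm : m ≤ ⌊(T + ε) * m⌋₊ := by
    apply Nat.le_floor
    exact le_mul_of_one_le_left (by positivity) (by linarith)
  have hNR : (T + ε) * m - 1 < (⌊(T + ε) * m⌋₊ : ℝ) := Nat.sub_one_lt_floor _
  obtain ⟨b, A, hA, hmono, hpg⟩ := hN0 _ (hmN0.trans hNm) c hc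
  have hg : γ ≤ 1 / T := min_le_left _ _
  have h1 : (1 / T - γ) * ((T + ε) * m - 1) ≤ #(brPages c b A) := by
    refine le_trans ?_ hpg
    exact mul_le_mul_of_nonneg_left hNR.le (by linarith)
  have h2 : (1 / T - γ) * ((T + ε) * m - 1) =
      m + ε / T * m - γ * (T + ε) * m - (1 / T - γ) := by field_simp
  have h3 : γ * (T + ε) * m ≤ ε / (2 * T) * m := by gcongr
  have h4 : ε / T * m = ε / (2 * T) * m + ε / (2 * T) * m := by ring
  have h5 : 1 / T ≤ 1 := by rw [div_le_one hTp]; exact hT1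
  have h6 : (m + t : ℝ) ≤ #(brPages c b A) := by linarith
  have h7 : m + t ≤ #(brPages c b A) := by exact_mod_cast h6
  have h8 : m ≤ #(brPages c b A \ A) := by
    have := le_card_sdiff A (brPages c b A)
    omega
  obtain ⟨Y, hY, hYc⟩ := exists_subset_card_eq h8
  refine ⟨A, Y, b, ?_, hA, hYc, hmono, fun v hv w hw => ?_⟩
  · exact disjoint_of_subset_right hY disjoint_sdiff
  · have := (mem_sdiff.1 (hY hw)).1
    rw [hc]
    simp only [brPages, mem_filter, mem_univ, true_and] at this
    exact this v hv


end BookAux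

/-- **Conlon's theorem.** For every fixed positive integer `t`,
`r(B_{t,m}) = (2^t + o(1)) m` as `m → ∞`: for every `ε > 0` there is `m₀` such that for
all `m ≥ m₀`, `(2^t - ε) m ≤ r(B_{t,m}) ≤ (2^t + ε) m`. -/
theorem bookRamsey_asymptotic (t : ℕ) (ht : 1 ≤ t) (ε : ℝ) (hε : 0 < ε) :
    ∃ m₀ : ℕ, ∀ m : ℕ, m₀ ≤ m →
      ((2 : ℝ) ^ t - ε) * m ≤ (bookRamsey t m : ℝ) ∧
        (bookRamsey t m : ℝ) ≤ ((2 : ℝ) ^ t + ε) * m := by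
  obtain ⟨m1, h1⟩ := br_lower t ε hε
  obtain ⟨m2, h2⟩ := br_upper t ht ε hε
  refine ⟨max m1 m2, fun m hm => ?_⟩
  have hu := h2 m ((le_max_right _ _).trans hm)
  have hmem : ⌊((2:ℝ) ^ t + ε) * m⌋₊ ∈ {N | ∀ c : Fin N → Fin N → Bool,
    (∀ v w, c v w = c w v) → HasMonoBook N t m c} := hu
  constructor
  · by_contra! hlt
    obtain ⟨c, hc, hno⟩ := h1 m ((le_max_left _ _).trans hm) _ hlt
    exact hno (Nat.sInf_mem ⟨_, hmem⟩ c hc)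
  · have h3 : bookRamsey t m ≤ ⌊((2:ℝ) ^ t + ε) * m⌋₊ := Nat.sInf_le hmem
    have h4 : (bookRamsey t m : ℝ) ≤ (⌊((2:ℝ) ^ t + ε) * m⌋₊ : ℝ) := by exact_mod_cast h3
    exact h4.trans (Nat.floor_le (by positivity))
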